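/- Let u be the solution of the interior problem with parameters d > 0 and boundary value c > 0 (so u > 0 on Ω∖{0}), and let P = |Du|²/u^{2(n−1)/(n−2)} be its P-function. Assume that P is constant on ∂Ω with value sup_{Ω∖{0}} P, and that sup_{∂Ω} [ H/(n−1) − |Du|/((n−2)u) ] ≥ 0. Then at every point of Ω∖{0} the Hessian identity u · D²u = (n/(n−2)) Du ⊗ Du − (|Du|²/(n−2)) · Id holds; equivalently, the Hessian of f = log u with respect to the conformal metric g = u^{2/(n−2)}·(Euclidean metric) vanishes identically on Ω∖{0}. -/

import Mathlib

open MeasureTheory Metric Set Filter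
open scoped Topology ENNReal NNReal InnerProductSpace

noncomputable section

/-- Hessian of `u` at `x`, evaluated on the pair of vectors `(v, w)`. -/
def hess2 {n : ℕ} (u : EuclideanSpace ℝ (Fin n) → ℝ) (x v w : EuclideanSpace ℝ (Fin n)) : ℝ :=
  iteratedFDeriv ℝ 2 u x ![v, w]

/-- Laplacian of `u` at `x`. -/
def lap {n : ℕ} (u : EuclideanSpace ℝ (Fin n) → ℝ) (x : EuclideanSpace ℝ (Fin n)) : ℝ :=
  ∑ i : Fin n, hess2 u x (EuclideanSpace.single i 1) (EuclideanSpace.single i 1)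

/-- Mean curvature at `x` of the level set of `u` through `x`, with respect to the unit
normal `ν = -Du/|Du|`:  `H = D²u(ν,ν)/|Du|` (valid for harmonic `u`). -/
def meanH {n : ℕ} (u : EuclideanSpace ℝ (Fin n) → ℝ) (x : EuclideanSpace ℝ (Fin n)) : ℝ :=
  hess2 u x (gradient u x) (gradient u x) / ‖gradient u x‖ ^ 3

/-- `(n-1)`-dimensional Hausdorff measure (area) of a subset of `ℝⁿ`. -/
def sArea {n : ℕ} (s : Set (EuclideanSpace ℝ (Fin n))) : ℝ :=
  (μH[(n : ℝ) - 1] s).toReal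

/-- Area of the unit sphere `𝕊^{n-1} ⊆ ℝⁿ`. -/
def sphereArea (n : ℕ) : ℝ := sArea (Metric.sphere (0 : EuclideanSpace ℝ (Fin n)) 1)

/-- `Ω` is a bounded domain containing the origin. -/
def GoodDomain {n : ℕ} (Ω : Set (EuclideanSpace ℝ (Fin n))) : Prop :=
  IsOpen Ω ∧ IsConnected Ω ∧ Bornology.IsBounded Ω ∧ (0 : EuclideanSpace ℝ (Fin n)) ∈ Ω

/-- The exterior problem: `u` is smooth up to the boundary on `ℝⁿ∖Ω`, harmonic in
`ℝⁿ∖closure(Ω)`, equal to `1` on `∂Ω`, and tends to `0` at infinity. -/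
def ExteriorSol {n : ℕ} (Ω : Set (EuclideanSpace ℝ (Fin n)))
    (u : EuclideanSpace ℝ (Fin n) → ℝ) : Prop :=
  (∃ U, IsOpen U ∧ Ωᶜ ⊆ U ∧ ContDiffOn ℝ (⊤ : ℕ∞) u U) ∧
  (∀ x ∈ (closure Ω)ᶜ, lap u x = 0) ∧
  (∀ x ∈ frontier Ω, u x = 1) ∧
  Tendsto u (cocompact (EuclideanSpace ℝ (Fin n))) (nhds 0)

/-- The interior problem with parameters `d > 0` and `c`: `u` is smooth up to the boundary away
from the origin, harmonic in `Ω∖{0}`, equal to `c` on `∂Ω`, and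
`u - d|∂Ω||x|^{2-n}/((n-2)|𝕊^{n-1}|)` extends to a harmonic function on `Ω`. -/
def InteriorSol {n : ℕ} (Ω : Set (EuclideanSpace ℝ (Fin n))) (d c : ℝ)
    (u : EuclideanSpace ℝ (Fin n) → ℝ) : Prop :=
  (∃ U, IsOpen U ∧ closure Ω ⊆ U ∧ ContDiffOn ℝ (⊤ : ℕ∞) u (U \ {0})) ∧
  (∀ x ∈ Ω \ {(0 : EuclideanSpace ℝ (Fin n))}, lap u x = 0) ∧
  (∀ x ∈ frontier Ω, u x = c) ∧
  (∃ v : EuclideanSpace ℝ (Fin n) → ℝ, ContDiffOn ℝ (⊤ : ℕ∞) v Ω ∧ (∀ x ∈ Ω, lap v x = 0) ∧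
    ∀ x ∈ Ω \ {(0 : EuclideanSpace ℝ (Fin n))},
      u x = d * sArea (frontier Ω) / (((n : ℝ) - 2) * sphereArea n) * ‖x‖ ^ ((2 : ℝ) - n) + v x)

/-- The `P`-function `|Du|²/u^{2(n-1)/(n-2)} = |∇f|_g²`. -/
def Pfun {n : ℕ} (u : EuclideanSpace ℝ (Fin n) → ℝ) (x : EuclideanSpace ℝ (Fin n)) : ℝ :=
  ‖gradient u x‖ ^ 2 / u x ^ (2 * ((n : ℝ) - 1) / ((n : ℝ) - 2))

/-- `|∇f|_g = |Du|/u^{(n-1)/(n-2)}`, the `g`-length of the gradient of `f = log u`. -/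
def gradg {n : ℕ} (u : EuclideanSpace ℝ (Fin n) → ℝ) (x : EuclideanSpace ℝ (Fin n)) : ℝ :=
  ‖gradient u x‖ / u x ^ (((n : ℝ) - 1) / ((n : ℝ) - 2))

/-- The tensor `T = D²f - (1/(n-2))(2 df⊗df - |Df|² Id)` for `f = log u`, evaluated on `(v,w)`. -/
def Tlog {n : ℕ} (u : EuclideanSpace ℝ (Fin n) → ℝ) (x v w : EuclideanSpace ℝ (Fin n)) : ℝ :=
  hess2 (fun y => Real.log (u y)) x v w -
    (1 / ((n : ℝ) - 2)) *
      (2 * ⟪gradient (fun y => Real.log (u y)) x, v⟫_ℝ *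
          ⟪gradient (fun y => Real.log (u y)) x, w⟫_ℝ -
        ‖gradient (fun y => Real.log (u y)) x‖ ^ 2 * ⟪v, w⟫_ℝ)

/-- `|∇²f|_g² = u^{-4/(n-2)} |T|²`, the squared `g`-norm of the `g`-Hessian of `f = log u`. -/
def hessgSq {n : ℕ} (u : EuclideanSpace ℝ (Fin n) → ℝ) (x : EuclideanSpace ℝ (Fin n)) : ℝ :=
  u x ^ (-(4 : ℝ) / ((n : ℝ) - 2)) *
    ∑ i : Fin n, ∑ j : Fin n,
      (Tlog u x (EuclideanSpace.single i 1) (EuclideanSpace.single j 1)) ^ 2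

/-- The `g`-mean curvature of a regular level set of `u`:
`H_g/(n-1) = u^{-1/(n-2)} ( H/(n-1) - |Du|/((n-2)u) )`. -/
def Hg {n : ℕ} (u : EuclideanSpace ℝ (Fin n) → ℝ) (x : EuclideanSpace ℝ (Fin n)) : ℝ :=
  ((n : ℝ) - 1) * u x ^ (-(1 : ℝ) / ((n : ℝ) - 2)) *
    (meanH u x / ((n : ℝ) - 1) - ‖gradient u x‖ / (((n : ℝ) - 2) * u x))

/-- The pointwise Hessian identity `u·D²u = (n/(n-2)) Du⊗Du - (|Du|²/(n-2)) Id`, equivalent to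
the vanishing of the `g`-Hessian of `f = log u`. -/
def HessId {n : ℕ} (u : EuclideanSpace ℝ (Fin n) → ℝ) (x : EuclideanSpace ℝ (Fin n)) : Prop :=
  ∀ v w : EuclideanSpace ℝ (Fin n),
    u x * hess2 u x v w =
      ((n : ℝ) / ((n : ℝ) - 2)) * (⟪gradient u x, v⟫_ℝ * ⟪gradient u x, w⟫_ℝ) -
        (‖gradient u x‖ ^ 2 / ((n : ℝ) - 2)) * ⟪v, w⟫_ℝ

/-- The `i`-th partial derivative of `f`. -/
def pd {n : ℕ} (i : Fin n) (f : EuclideanSpace ℝ (Fin n) → ℝ) (x : EuclideanSpace ℝ (Fin n)) : ℝ :=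
  fderiv ℝ f x (EuclideanSpace.single i 1)

section PartialDerivatives

variable {n : ℕ} {V : Set (EuclideanSpace ℝ (Fin n))} {f g : EuclideanSpace ℝ (Fin n) → ℝ}
  {x : EuclideanSpace ℝ (Fin n)}

lemma differentiableAt_of_contDiffOn_top (hV : IsOpen V) (hf : ContDiffOn ℝ (⊤ : ℕ∞) f V)
    (hx : x ∈ V) : DifferentiableAt ℝ f x :=
  (hf.contDiffAt (hV.mem_nhds hx)).differentiableAt (by simp)

lemma contDiffOn_pd (hV : IsOpen V) (hf : ContDiffOn ℝ (⊤ : ℕ∞) f V) (i : Fin n) :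
    ContDiffOn ℝ (⊤ : ℕ∞) (pd i f) V :=
  (hf.fderiv_of_isOpen hV (m := (⊤ : ℕ∞)) (by norm_cast)).clm_apply contDiffOn_const

lemma pd_congr (hV : IsOpen V) (h : EqOn f g V) (i : Fin n) : EqOn (pd i f) (pd i g) V := by
  intro x hx
  have : f =ᶠ[𝓝 x] g := h.eventuallyEq_of_mem (hV.mem_nhds hx)
  simp only [pd, this.fderiv_eq]

lemma hess2_apply (v w : EuclideanSpace ℝ (Fin n)) :
    hess2 f x v w = fderiv ℝ (fderiv ℝ f) x v w := by
  simp [hess2, iteratedFDeriv_two_apply]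

lemma lap_congr (hV : IsOpen V) (h : EqOn f g V) : EqOn (lap f) (lap g) V := by
  intro x hx
  have : f =ᶠ[𝓝 x] g := h.eventuallyEq_of_mem (hV.mem_nhds hx)
  simp only [lap, hess2_apply, this.fderiv.fderiv_eq]

lemma pd_pd (hV : IsOpen V) (hf : ContDiffOn ℝ (⊤ : ℕ∞) f V) (hx : x ∈ V) (i j : Fin n) :
    pd i (pd j f) x =
      hess2 f x (EuclideanSpace.single i 1) (EuclideanSpace.single j 1) := by
  have h : DifferentiableAt ℝ (fderiv ℝ f) x :=
    ((hf.fderiv_of_isOpen hV (m := (⊤ : ℕ∞)) (by norm_cast)).contDiffAt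
      (hV.mem_nhds hx)).differentiableAt (by simp)
  rw [hess2_apply]
  rw [pd, show pd j f =
    fun y => (fderiv ℝ f y) ((fun _ => EuclideanSpace.single j 1) y) from rfl,
    fderiv_clm_apply h (differentiableAt_const _)]
  simp

lemma pd_comm (hV : IsOpen V) (hf : ContDiffOn ℝ (⊤ : ℕ∞) f V) (i j : Fin n) :
    EqOn (pd i (pd j f)) (pd j (pd i f)) V := by
  intro x hx
  rw [pd_pd hV hf hx, pd_pd hV hf hx, hess2_apply, hess2_apply]
  exact (hf.contDiffAt (hV.mem_nhds hx)).isSymmSndFDerivAt (by simp; norm_cast) _ _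

lemma lap_eq_sum_pd (hV : IsOpen V) (hf : ContDiffOn ℝ (⊤ : ℕ∞) f V) (hx : x ∈ V) :
    lap f x = ∑ i, pd i (pd i f) x := by
  simp only [lap, pd_pd hV hf hx]

lemma pd_add (hf : DifferentiableAt ℝ f x) (hg : DifferentiableAt ℝ g x) (i : Fin n) :
    pd i (fun y => f y + g y) x = pd i f x + pd i g x := by
  simp [pd, fderiv_fun_add hf hg]

lemma pd_mul (hf : DifferentiableAt ℝ f x) (hg : DifferentiableAt ℝ g x) (i : Fin n) :
    pd i (fun y => f y * g y) x = pd i f x * g x + f x * pd i g x := by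
  simp [pd, fderiv_fun_mul hf hg]; ring

@[simp]
lemma pd_const (a : ℝ) (i : Fin n) : pd i (fun _ => a) x = 0 := by
  simp [pd]

lemma pd_sum {ι : Type*} {s : Finset ι} {F : ι → EuclideanSpace ℝ (Fin n) → ℝ}
    (hF : ∀ k ∈ s, DifferentiableAt ℝ (F k) x) (i : Fin n) :
    pd i (fun y => ∑ k ∈ s, F k y) x = ∑ k ∈ s, pd i (F k) x := by
  simp [pd, fderiv_fun_sum hF]

lemma pd_rpow (hf : DifferentiableAt ℝ f x) (h0 : f x ≠ 0) (r : ℝ) (i : Fin n) :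
    pd i (fun y => f y ^ r) x = r * f x ^ (r - 1) * pd i f x := by
  simp [pd, (hf.hasFDerivAt.rpow_const (Or.inl h0)).fderiv]

lemma pd_exp (hf : DifferentiableAt ℝ f x) (i : Fin n) :
    pd i (fun y => Real.exp (f y)) x = Real.exp (f x) * pd i f x := by
  simp [pd, (hf.hasFDerivAt.exp).fderiv]

lemma pd_norm_sub_sq (a : EuclideanSpace ℝ (Fin n)) (i : Fin n) :
    pd i (fun y => ‖y - a‖ ^ 2) x = 2 * (x i - a i) := by
  have h : HasFDerivAt (fun y => ‖y - a‖ ^ 2) _ x := ((hasFDerivAt_id x).sub_const a).norm_sq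
  simp [pd, h.fderiv, EuclideanSpace.inner_single_right]

lemma pd_coord_sub (a : ℝ) (i : Fin n) :
    pd i (fun y => y i - a) x = 1 := by
  have h : HasFDerivAt (fun y : EuclideanSpace ℝ (Fin n) => y i - a)
    (EuclideanSpace.proj i : EuclideanSpace ℝ (Fin n) →L[ℝ] ℝ) x :=
    (EuclideanSpace.proj i : EuclideanSpace ℝ (Fin n) →L[ℝ] ℝ).hasFDerivAt.sub_const a
  simp [pd, h.fderiv]

lemma lap_add (hV : IsOpen V) (hf : ContDiffOn ℝ (⊤ : ℕ∞) f V) (hg : ContDiffOn ℝ (⊤ : ℕ∞) g V)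
    (hx : x ∈ V) : lap (fun y => f y + g y) x = lap f x + lap g x := by
  rw [lap_eq_sum_pd hV hf hx, lap_eq_sum_pd hV hg hx, lap_eq_sum_pd hV (hf.add hg) hx,
    ← Finset.sum_add_distrib]
  refine Finset.sum_congr rfl fun i _ => ?_
  rw [pd_congr hV (g := fun y => pd i f y + pd i g y) (fun y hy => pd_add
      (differentiableAt_of_contDiffOn_top hV hf hy)
      (differentiableAt_of_contDiffOn_top hV hg hy) i) i hx,
    pd_add (differentiableAt_of_contDiffOn_top hV (contDiffOn_pd hV hf i) hx)
      (differentiableAt_of_contDiffOn_top hV (contDiffOn_pd hV hg i) hx)]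

@[simp]
lemma lap_const (a : ℝ) : lap (fun _ : EuclideanSpace ℝ (Fin n) => a) x = 0 := by
  simp [lap, hess2_apply]

lemma lap_mul (hV : IsOpen V) (hf : ContDiffOn ℝ (⊤ : ℕ∞) f V) (hg : ContDiffOn ℝ (⊤ : ℕ∞) g V)
    (hx : x ∈ V) :
    lap (fun y => f y * g y) x =
      lap f x * g x + 2 * ∑ i, pd i f x * pd i g x + f x * lap g x := by
  have df := fun y (hy : y ∈ V) => differentiableAt_of_contDiffOn_top hV hf hy
  have dg := fun y (hy : y ∈ V) => differentiableAt_of_contDiffOn_top hV hg hy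
  have ddf := fun i => differentiableAt_of_contDiffOn_top hV (contDiffOn_pd hV hf i) hx
  have ddg := fun i => differentiableAt_of_contDiffOn_top hV (contDiffOn_pd hV hg i) hx
  rw [lap_eq_sum_pd hV hf hx, lap_eq_sum_pd hV hg hx, lap_eq_sum_pd hV (hf.mul hg) hx,
    Finset.sum_mul, Finset.mul_sum, Finset.mul_sum, ← Finset.sum_add_distrib,
    ← Finset.sum_add_distrib]
  refine Finset.sum_congr rfl fun i _ => ?_
  rw [pd_congr hV (g := fun y => pd i f y * g y + f y * pd i g y)
      (fun y hy => pd_mul (df y hy) (dg y hy) i) i hx,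
    pd_add ((ddf i).fun_mul (dg x hx)) ((df x hx).fun_mul (ddg i)), pd_mul (ddf i) (dg x hx),
    pd_mul (df x hx) (ddg i)]
  ring

lemma lap_const_mul (hV : IsOpen V) (hf : ContDiffOn ℝ (⊤ : ℕ∞) f V) (hx : x ∈ V) (a : ℝ) :
    lap (fun y => a * f y) x = a * lap f x := by
  rw [lap_mul hV contDiffOn_const hf hx]
  simp

lemma lap_sum {ι : Type*} {s : Finset ι} {F : ι → EuclideanSpace ℝ (Fin n) → ℝ} (hV : IsOpen V)
    (hF : ∀ k, ContDiffOn ℝ (⊤ : ℕ∞) (F k) V) (hx : x ∈ V) :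
    lap (fun y => ∑ k ∈ s, F k y) x = ∑ k ∈ s, lap (F k) x := by
  classical
  induction s using Finset.induction_on with
  | empty => simp
  | insert a s ha ih =>
    simp only [Finset.sum_insert ha]
    rw [lap_add hV (hF a) (ContDiffOn.sum fun k _ => hF k) hx, ih]

lemma lap_rpow (hV : IsOpen V) (hf : ContDiffOn ℝ (⊤ : ℕ∞) f V) (h0 : ∀ y ∈ V, 0 < f y)
    (hx : x ∈ V) (r : ℝ) :
    lap (fun y => f y ^ r) x =
      r * f x ^ (r - 1) * lap f x + r * (r - 1) * f x ^ (r - 2) * ∑ i, pd i f x ^ 2 := by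
  have df := fun y (hy : y ∈ V) => differentiableAt_of_contDiffOn_top hV hf hy
  have ddf := fun i => differentiableAt_of_contDiffOn_top hV (contDiffOn_pd hV hf i) hx
  have hr : ∀ r : ℝ, ContDiffOn ℝ (⊤ : ℕ∞) (fun y => f y ^ r) V := fun r =>
    hf.rpow_const_of_ne fun y hy => (h0 y hy).ne'
  rw [lap_eq_sum_pd hV hf hx, lap_eq_sum_pd hV (hr r) hx, Finset.mul_sum, Finset.mul_sum,
    ← Finset.sum_add_distrib]
  refine Finset.sum_congr rfl fun i _ => ?_
  have d1 := differentiableAt_of_contDiffOn_top hV (hr (r - 1)) hx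
  rw [pd_congr hV (g := fun y => (r * f y ^ (r - 1)) * pd i f y)
      (fun y hy => pd_rpow (df y hy) (h0 y hy).ne' r i) i hx,
    pd_mul (d1.const_mul r) (ddf i), pd_mul (differentiableAt_const _) d1, pd_const,
    pd_rpow (df x hx) (h0 x hx).ne', show r - 1 - 1 = r - 2 by ring]
  ring

lemma lap_norm_sub_sq (a : EuclideanSpace ℝ (Fin n)) :
    lap (fun y => ‖y - a‖ ^ 2) x = 2 * n := by
  have hs : ContDiffOn ℝ (⊤ : ℕ∞) (fun y : EuclideanSpace ℝ (Fin n) => ‖y - a‖ ^ 2) univ :=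
    ((contDiff_id.sub contDiff_const).norm_sq ℝ).contDiffOn
  rw [lap_eq_sum_pd isOpen_univ hs (mem_univ x)]
  have : ∀ i : Fin n, pd i (pd i fun y => ‖y - a‖ ^ 2) x = 2 := by
    intro i
    rw [show (pd i fun y => ‖y - a‖ ^ 2) = fun y => 2 * (y i - a i) from
      funext fun y => pd_norm_sub_sq a i, pd_mul (by fun_prop) (by fun_prop), pd_coord_sub]
    simp
  simp [this]
  ring

lemma lap_exp_norm_sub_sq (a : EuclideanSpace ℝ (Fin n)) (b : ℝ) :
    lap (fun y => Real.exp (-b * ‖y - a‖ ^ 2)) x =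
      (4 * b ^ 2 * ‖x - a‖ ^ 2 - 2 * b * n) * Real.exp (-b * ‖x - a‖ ^ 2) := by
  have hq : ContDiff ℝ (⊤ : ℕ∞) (fun y : EuclideanSpace ℝ (Fin n) => ‖y - a‖ ^ 2) :=
    (contDiff_id.sub contDiff_const).norm_sq ℝ
  have hs := (contDiff_const (c := -b)).mul hq |>.exp
  have dq : ∀ y, DifferentiableAt ℝ (fun y : EuclideanSpace ℝ (Fin n) => ‖y - a‖ ^ 2) y :=
    fun y => hq.differentiable (by simp) y
  have de : ∀ y, DifferentiableAt ℝ
    (fun y : EuclideanSpace ℝ (Fin n) => Real.exp (-b * ‖y - a‖ ^ 2)) y :=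
    fun y => hs.differentiable (by simp) y
  have p1 : ∀ (i : Fin n) y, pd i (fun y => Real.exp (-b * ‖y - a‖ ^ 2)) y =
      Real.exp (-b * ‖y - a‖ ^ 2) * (-2 * b * (y i - a i)) := by
    intro i y
    rw [pd_exp ((dq y).const_mul _), pd_mul (differentiableAt_const _) (dq y), pd_norm_sub_sq]
    simp
    ring
  rw [lap_eq_sum_pd isOpen_univ hs.contDiffOn (mem_univ x)]
  have p2 : ∀ i : Fin n, pd i (pd i fun y => Real.exp (-b * ‖y - a‖ ^ 2)) x =
      (4 * b ^ 2 * (x i - a i) ^ 2 - 2 * b) * Real.exp (-b * ‖x - a‖ ^ 2) := by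
    intro i
    rw [show (pd i fun y => Real.exp (-b * ‖y - a‖ ^ 2)) = _ from funext (p1 i),
      pd_mul (de x) (by fun_prop), p1, pd_mul (by fun_prop) (by fun_prop), pd_coord_sub]
    simp
    ring
  simp only [p2]
  rw [← Finset.sum_mul, Finset.sum_sub_distrib, ← Finset.mul_sum, EuclideanSpace.real_norm_sq_eq]
  simp
  ring

lemma inner_gradient_eq (v : EuclideanSpace ℝ (Fin n)) :
    ⟪gradient f x, v⟫_ℝ = fderiv ℝ f x v := inner_gradient_left

lemma gradient_apply (i : Fin n) : gradient f x i = pd i f x := by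
  rw [pd, ← inner_gradient_eq, EuclideanSpace.inner_single_right]
  simp

lemma norm_gradient_sq : ‖gradient f x‖ ^ 2 = ∑ i, pd i f x ^ 2 := by
  simp [EuclideanSpace.real_norm_sq_eq, gradient_apply]

lemma eq_sum_single (v : EuclideanSpace ℝ (Fin n)) :
    v = ∑ i, v i • EuclideanSpace.single i (1 : ℝ) := by
  simpa using ((EuclideanSpace.basisFun (Fin n) ℝ).sum_repr v).symm

lemma fderiv_eq_sum_pd (v : EuclideanSpace ℝ (Fin n)) :
    fderiv ℝ f x v = ∑ i, v i * pd i f x := by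
  conv_lhs => rw [eq_sum_single v]
  simp [pd]

lemma hess2_eq_sum_pd (hV : IsOpen V) (hf : ContDiffOn ℝ (⊤ : ℕ∞) f V) (hx : x ∈ V)
    (v w : EuclideanSpace ℝ (Fin n)) :
    hess2 f x v w = ∑ i, ∑ j, v i * w j * pd i (pd j f) x := by
  simp only [pd_pd hV hf hx, hess2_apply]
  conv_lhs => rw [eq_sum_single v, eq_sum_single w]
  simp only [map_sum, map_smul, sum_apply, smul_apply,
    smul_eq_mul, Finset.mul_sum]
  rw [Finset.sum_comm]
  refine Finset.sum_congr rfl fun i _ => Finset.sum_congr rfl fun j _ => ?_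
  ring

end PartialDerivatives

section MaximumPrinciple

variable {n : ℕ} {V Ω : Set (EuclideanSpace ℝ (Fin n))} {f q w : EuclideanSpace ℝ (Fin n) → ℝ}
  {x : EuclideanSpace ℝ (Fin n)}

lemma pd_pd_nonneg_of_isLocalMin (hV : IsOpen V) (hf : ContDiffOn ℝ (⊤ : ℕ∞) f V) (hx : x ∈ V)
    (hm : IsLocalMin f x) (i : Fin n) : 0 ≤ pd i (pd i f) x := by
  by_contra! hneg
  set e : EuclideanSpace ℝ (Fin n) := EuclideanSpace.single i 1
  have hline : ∀ t : ℝ, HasDerivAt (fun t : ℝ => x + t • e) e t := fun t => by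
    simpa using ((hasDerivAt_id t).smul_const e).const_add x
  have hcont : ContinuousAt (fun t : ℝ => x + t • e) 0 := (hline 0).continuousAt
  have hx0 : x + (0 : ℝ) • e = x := by simp
  have hderiv : ∀ g : EuclideanSpace ℝ (Fin n) → ℝ, ContDiffOn ℝ (⊤ : ℕ∞) g V →
      ∀ᶠ t in 𝓝 (0 : ℝ), HasDerivAt (fun t : ℝ => g (x + t • e)) (pd i g (x + t • e)) t := by
    intro g hg
    have : ∀ᶠ t in 𝓝 (0 : ℝ), x + t • e ∈ V :=
      hcont.eventually (hV.mem_nhds (by simpa [hx0] using hx))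
    filter_upwards [this] with t ht
    exact (differentiableAt_of_contDiffOn_top hV hg ht).hasFDerivAt.comp_hasDerivAt t (hline t)
  have h1 : deriv (fun t : ℝ => f (x + t • e)) =ᶠ[𝓝 0] fun t => pd i f (x + t • e) :=
    (hderiv f hf).mono fun t ht => ht.deriv
  have h2 : deriv (deriv fun t : ℝ => f (x + t • e)) 0 = pd i (pd i f) x := by
    rw [h1.deriv_eq, (hderiv _ (contDiffOn_pd hV hf i)).self_of_nhds.deriv, hx0]
  have hmin : IsLocalMin (fun t : ℝ => f (x + t • e)) 0 := by
    have : Tendsto (fun t : ℝ => x + t • e) (𝓝 0) (𝓝 x) := by simpa [ContinuousAt] using hcont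
    filter_upwards [this.eventually hm] with t ht
    simpa using ht
  have hmax : IsLocalMax (fun t : ℝ => f (x + t • e)) 0 :=
    isLocalMax_of_deriv_deriv_neg (by rw [h2]; exact hneg) hmin.deriv_eq_zero
      (hderiv f hf).self_of_nhds.continuousAt
  have hconst : (fun t : ℝ => f (x + t • e)) =ᶠ[𝓝 0] fun _ => f (x + (0 : ℝ) • e) := by
    filter_upwards [hmin, hmax] with t h1 h2 using le_antisymm h2 h1
  have : deriv (deriv fun t : ℝ => f (x + t • e)) 0 = 0 := by
    rw [hconst.deriv.deriv_eq]
    simp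
  linarith

lemma lap_nonneg_of_isLocalMin (hV : IsOpen V) (hf : ContDiffOn ℝ (⊤ : ℕ∞) f V) (hx : x ∈ V)
    (hm : IsLocalMin f x) : 0 ≤ lap f x := by
  rw [lap_eq_sum_pd hV hf hx]
  exact Finset.sum_nonneg fun i _ => pd_pd_nonneg_of_isLocalMin hV hf hx hm i

lemma nonneg_of_lap_neg (hV : IsOpen V) (hb : Bornology.IsBounded V)
    (hc : ContinuousOn f (closure V)) (hf : ContDiffOn ℝ (⊤ : ℕ∞) f V)
    (hl : ∀ x ∈ V, lap f x < 0) (h0 : ∀ x ∈ frontier V, 0 ≤ f x) : ∀ x ∈ V, 0 ≤ f x := by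
  intro x hx
  obtain ⟨y, hy, hmin⟩ := hb.isCompact_closure.exists_isMinOn ⟨x, subset_closure hx⟩ hc
  have hyx : f y ≤ f x := hmin (subset_closure hx)
  by_cases hyV : y ∈ V
  · have : IsLocalMin f y :=
      (hmin.on_subset subset_closure).isLocalMin (hV.mem_nhds hyV)
    exact absurd (lap_nonneg_of_isLocalMin hV hf hyV this) (not_le.2 (hl y hyV))
  · refine (h0 y ?_).trans hyx
    rw [hV.frontier_eq]
    exact ⟨hy, hyV⟩

/-- The weak minimum principle for superharmonic functions. -/
lemma nonneg_of_lap_nonpos (hn : 0 < n) (hV : IsOpen V) (hb : Bornology.IsBounded V)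
    (hc : ContinuousOn f (closure V)) (hf : ContDiffOn ℝ (⊤ : ℕ∞) f V)
    (hl : ∀ x ∈ V, lap f x ≤ 0) (h0 : ∀ x ∈ frontier V, 0 ≤ f x) : ∀ x ∈ V, 0 ≤ f x := by
  intro x hx
  obtain ⟨R, hR⟩ := hb.closure.exists_norm_le
  refine le_of_forall_pos_le_add fun ε hε => ?_
  set δ := ε / (R ^ 2 + 1) with hδ
  have hδ0 : 0 < δ := by positivity
  have hs : ContDiff ℝ (⊤ : ℕ∞) (fun y : EuclideanSpace ℝ (Fin n) => ‖y - 0‖ ^ 2) :=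
    (contDiff_id.sub contDiff_const).norm_sq ℝ
  have hs' : ContDiff ℝ (⊤ : ℕ∞)
      (fun y : EuclideanSpace ℝ (Fin n) => δ * R ^ 2 + -δ * ‖y - 0‖ ^ 2) :=
    contDiff_const.add (contDiff_const.mul hs)
  have key := nonneg_of_lap_neg (f := fun y => f y + (δ * R ^ 2 + -δ * ‖y - 0‖ ^ 2)) hV hb
    (hc.add hs'.continuous.continuousOn) (hf.add hs'.contDiffOn) (fun y hy => by
      rw [lap_add hV hf hs'.contDiffOn hy, lap_add hV contDiffOn_const
        (contDiff_const.mul hs).contDiffOn hy, lap_const_mul hV hs.contDiffOn hy,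
        lap_norm_sub_sq, lap_const]
      have : (0 : ℝ) < n := by exact_mod_cast hn
      have := hl y hy
      nlinarith [mul_pos hδ0 (by exact_mod_cast hn : (0 : ℝ) < n)]) (fun y hy => by
      have h1 := h0 y hy
      have h2 : ‖y‖ ^ 2 ≤ R ^ 2 :=
        pow_le_pow_left₀ (norm_nonneg _) (hR y (frontier_subset_closure hy)) 2
      rw [sub_zero]
      nlinarith) x hx
  have h3 : δ * R ^ 2 ≤ ε := by
    rw [hδ, div_mul_eq_mul_div, div_le_iff₀ (by positivity)]
    nlinarith
  have h4 : 0 ≤ δ * ‖x - 0‖ ^ 2 := by positivity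
  linarith

/-- A weak minimum principle in a punctured domain. -/
lemma nonneg_of_lap_nonpos_of_sphere (hn : 0 < n) (hΩ : IsOpen Ω) (hb : Bornology.IsBounded Ω)
    (hc : ContinuousOn f (closure Ω \ {0})) (hf : ContDiffOn ℝ (⊤ : ℕ∞) f (Ω \ {0}))
    (hl : ∀ x ∈ Ω \ {0}, lap f x ≤ 0) (h0 : ∀ x ∈ frontier Ω, 0 ≤ f x) {η : ℝ} (hη : 0 < η)
    (hs : ∀ x ∈ Ω, ‖x‖ = η → 0 ≤ f x) : ∀ x ∈ Ω, η < ‖x‖ → 0 ≤ f x := by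
  intro x hx hxη
  have hVo : IsOpen (Ω ∩ {x | η < ‖x‖}) :=
    hΩ.inter (isOpen_lt continuous_const continuous_norm)
  have hcl : closure (Ω ∩ {x | η < ‖x‖}) ⊆ closure Ω ∩ {x | η ≤ ‖x‖} :=
    (closure_inter_subset_inter_closure _ _).trans <| inter_subset_inter_right _ <|
      closure_lt_subset_le continuous_const continuous_norm
  have hsub : Ω ∩ {x | η < ‖x‖} ⊆ Ω \ {0} := fun y hy => ⟨hy.1, by
    rintro rfl
    have := hy.2
    simp at this
    linarith⟩
  refine nonneg_of_lap_nonpos hn hVo (hb.subset inter_subset_left) (hc.mono fun y hy => ?_)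
    (hf.mono hsub) (fun y hy => hl y (hsub hy)) (fun y hy => ?_) x ⟨hx, hxη⟩
  · have h := hcl hy
    refine ⟨h.1, ?_⟩
    rintro rfl
    have := h.2
    simp at this
    linarith
  · rw [hVo.frontier_eq] at hy
    have h := hcl hy.1
    by_cases hyΩ : y ∈ Ω
    · refine hs y hyΩ (le_antisymm ?_ h.2)
      by_contra! hlt
      exact hy.2 ⟨hyΩ, hlt⟩
    · exact h0 y (by rw [hΩ.frontier_eq]; exact ⟨h.1, hyΩ⟩)

lemma pos_of_lap_nonpos_of_closedBall_subset (hV : IsOpen V) (hn : 0 < n)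
    (hw : ContDiffOn ℝ (⊤ : ℕ∞) w V) (hl : ∀ x ∈ V, lap w x ≤ 0) (h0 : ∀ x ∈ V, 0 ≤ w x)
    {y : EuclideanSpace ℝ (Fin n)} {ρ : ℝ} (hρ : closedBall y ρ ⊆ V) (hy : 0 < w y) :
    ∀ x ∈ ball y ρ, 0 < w x := by
  intro x hx
  have hρ0 : 0 < ρ := pos_of_mem_ball hx
  have hyV : y ∈ V := hρ (mem_closedBall_self hρ0.le)
  obtain ⟨η, hη0, hη⟩ : ∃ η > 0, ∀ z, dist z y ≤ η → w y / 2 < w z := by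
    have := (hw.continuousOn.continuousAt (hV.mem_nhds hyV)).eventually
      (lt_mem_nhds (half_lt_self hy))
    obtain ⟨η, hη, h⟩ := Metric.eventually_nhds_iff.1 this
    exact ⟨η / 2, by positivity, fun z hz => h (by linarith)⟩
  by_cases hxη : dist x y ≤ η
  · exact (half_pos hy).trans (hη x hxη)
  push Not at hxη
  set b : ℝ := n / (2 * η ^ 2) with hb
  have hnR : (0 : ℝ) < n := by exact_mod_cast hn
  have hb0 : 0 < b := by positivity
  set ε := w y / 2 with hε
  have hε0 : 0 < ε := by positivity
  set E : EuclideanSpace ℝ (Fin n) → ℝ := fun z => Real.exp (-b * ‖z - y‖ ^ 2) with hE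
  have hEs : ContDiff ℝ (⊤ : ℕ∞) E :=
    (contDiff_const.mul ((contDiff_id.sub contDiff_const).norm_sq ℝ)).exp
  have hEs' : ContDiff ℝ (⊤ : ℕ∞) (fun z => ε * Real.exp (-b * ρ ^ 2) + -ε * E z) :=
    contDiff_const.add (contDiff_const.mul hEs)
  set A : Set (EuclideanSpace ℝ (Fin n)) := {z | η < dist z y} ∩ ball y ρ with hA
  have hAo : IsOpen A :=
    (isOpen_lt continuous_const (continuous_id.dist continuous_const)).inter isOpen_ball
  have hAV : A ⊆ V := fun z hz => hρ (ball_subset_closedBall hz.2)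
  have hcl : closure A ⊆ {z | η ≤ dist z y} ∩ closedBall y ρ :=
    (closure_inter_subset_inter_closure _ _).trans <| inter_subset_inter
      (closure_lt_subset_le continuous_const (continuous_id.dist continuous_const))
      closure_ball_subset_closedBall
  have key := nonneg_of_lap_nonpos (f := fun z => w z + (ε * Real.exp (-b * ρ ^ 2) + -ε * E z))
    hn hAo (isBounded_ball.subset inter_subset_right)
    ((hw.continuousOn.mono fun z hz => hρ (hcl hz).2).add hEs'.continuous.continuousOn)
    ((hw.mono hAV).add hEs'.contDiffOn) (fun z hz => by
      rw [lap_add hAo (hw.mono hAV) hEs'.contDiffOn hz, lap_add hAo contDiffOn_const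
        (contDiff_const.mul hEs).contDiffOn hz, lap_const_mul hAo hEs.contDiffOn hz,
        lap_exp_norm_sub_sq, lap_const]
      have h1 := hl z (hAV hz)
      have h2 : η ^ 2 ≤ ‖z - y‖ ^ 2 := by
        rw [← dist_eq_norm]
        exact pow_le_pow_left₀ hη0.le (le_of_lt hz.1) 2
      have h3 : 0 ≤ 4 * b ^ 2 * ‖z - y‖ ^ 2 - 2 * b * n := by
        have : 4 * b ^ 2 * η ^ 2 = 2 * b * n := by
          rw [hb]; field_simp; ring
        nlinarith [mul_le_mul_of_nonneg_left h2 (by positivity : 0 ≤ 4 * b ^ 2)]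
      have h4 := mul_nonneg hε0.le (mul_nonneg h3 (Real.exp_pos (-b * ‖z - y‖ ^ 2)).le)
      linarith) (fun z hz => by
      rw [hAo.frontier_eq] at hz
      have hz1 := hcl hz.1
      by_cases h : dist z y ≤ η
      · have h1 := hη z h
        have h2 : E z ≤ 1 := by
          rw [hE]
          exact Real.exp_le_one_iff.2 (by nlinarith [sq_nonneg ‖z - y‖])
        have h3 := mul_pos hε0 (Real.exp_pos (-b * ρ ^ 2))
        nlinarith
      · have h1 : dist z y = ρ := by
          refine le_antisymm hz1.2 ?_
          by_contra! hlt
          exact hz.2 ⟨not_le.1 h, hlt⟩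
        have h2 := h0 z (hρ hz1.2)
        simp only [hE, ← dist_eq_norm, h1]
        linarith) x ⟨hxη, hx⟩
  have h5 : Real.exp (-b * ρ ^ 2) < E x := by
    rw [hE]
    refine Real.exp_lt_exp.2 ?_
    have : ‖x - y‖ ^ 2 < ρ ^ 2 := by
      rw [← dist_eq_norm]
      exact pow_lt_pow_left₀ hx dist_nonneg two_ne_zero
    nlinarith
  nlinarith

/-- The strong minimum principle for superharmonic functions. -/
lemma pos_of_lap_nonpos_of_isPreconnected (hV : IsOpen V) (hn : 0 < n) (hp : IsPreconnected V)
    (hw : ContDiffOn ℝ (⊤ : ℕ∞) w V) (hl : ∀ x ∈ V, lap w x ≤ 0) (h0 : ∀ x ∈ V, 0 ≤ w x)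
    {y : EuclideanSpace ℝ (Fin n)} (hyV : y ∈ V) (hy : 0 < w y) :
    ∀ x ∈ V, 0 < w x := by
  have hsub : V ⊆ V ∩ w ⁻¹' Ioi 0 := by
    refine hp.subset_of_closure_inter_subset (hw.continuousOn.isOpen_inter_preimage hV isOpen_Ioi)
      ⟨y, hyV, hyV, hy⟩ ?_
    rintro z ⟨hz, hzV⟩
    refine ⟨hzV, ?_⟩
    obtain ⟨r, hr, hrV⟩ := Metric.isOpen_iff.1 hV z hzV
    obtain ⟨t, ht, htz⟩ := Metric.mem_closure_iff.1 hz (r / 3) (by positivity)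
    refine pos_of_lap_nonpos_of_closedBall_subset hV hn hw hl h0 (y := t) (ρ := r / 2)
      (fun s hs => hrV ?_) ht.2 z ?_
    · rw [mem_ball]
      rw [mem_closedBall] at hs
      have := dist_triangle_right s z t
      have := dist_triangle s t z
      rw [dist_comm t z] at this
      linarith
    · rw [mem_ball]
      linarith
  exact fun x hx => (hsub hx).2

lemma isPreconnected_diff_singleton (hn : 2 ≤ n) (hΩ : IsOpen Ω) (hp : IsPreconnected Ω)
    (a : EuclideanSpace ℝ (Fin n)) : IsPreconnected (Ω \ {a}) := by
  by_cases ha : a ∈ Ω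
  swap
  · rwa [sdiff_singleton_eq_self ha]
  obtain ⟨r, hr, hrΩ⟩ := Metric.isOpen_iff.1 hΩ a ha
  have hrank : 1 < Module.rank ℝ (EuclideanSpace ℝ (Fin n)) := by
    rw [← Module.finrank_eq_rank, finrank_euclideanSpace_fin]
    exact_mod_cast hn
  have hball : IsPreconnected (ball a r \ {a}) := by
    have himg : ball a r \ {a} = (fun p : ℝ × EuclideanSpace ℝ (Fin n) => a + p.1 • p.2) ''
        (Ioo 0 r ×ˢ sphere 0 1) := by
      ext z
      constructor
      · rintro ⟨hz, hza⟩
        have h0 : 0 < ‖z - a‖ := norm_pos_iff.2 (sub_ne_zero.2 hza)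
        refine ⟨(‖z - a‖, ‖z - a‖⁻¹ • (z - a)), ⟨⟨h0, by simpa [dist_eq_norm] using hz⟩, ?_⟩, ?_⟩
        · simp [norm_smul, h0.ne']
        · simp [smul_smul, h0.ne']
      · rintro ⟨⟨t, s⟩, ⟨⟨ht0, htr⟩, hs⟩, rfl⟩
        have hs1 : ‖s‖ = 1 := by simpa using hs
        simp only at ht0 htr
        refine ⟨by simpa [norm_smul, hs1, abs_of_pos ht0] using htr, ?_⟩
        have : s ≠ 0 := by rintro rfl; simp at hs1
        simp [ht0.ne', this]
    rw [himg]
    exact (isPreconnected_Ioo.prod (isPreconnected_sphere hrank 0 1)).image _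
      (by fun_prop)
  have main : ∀ U W : Set (EuclideanSpace ℝ (Fin n)), IsOpen U → IsOpen W → Ω \ {a} ⊆ U ∪ W →
      (Ω \ {a}) ∩ (U ∩ W) = ∅ → ball a r \ {a} ⊆ U → Ω \ {a} ⊆ U ∨ Ω \ {a} ⊆ W := by
    intro U W hU hW hcov hdis hb
    left
    have hsub : Ω ⊆ U ∪ ball a r := by
      refine hp.subset_left_of_subset_union (hU.union isOpen_ball) (hW.inter hΩ |>.sdiff
        (isClosed_singleton (x := a))) ?_ ?_ ⟨a, ha, Or.inr (mem_ball_self hr)⟩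
      · rw [disjoint_left]
        rintro z hz ⟨⟨hzW, hzΩ⟩, hza⟩
        have hzU : z ∈ U := hz.elim id fun h => hb ⟨h, hza⟩
        have : z ∈ (Ω \ {a}) ∩ (U ∩ W) := ⟨⟨hzΩ, hza⟩, hzU, hzW⟩
        simp [hdis] at this
      · intro z hz
        by_cases hza : z = a
        · subst hza
          exact Or.inl (Or.inr (mem_ball_self hr))
        · rcases hcov ⟨hz, hza⟩ with h | h
          · exact Or.inl (Or.inl h)
          · exact Or.inr ⟨⟨h, hz⟩, hza⟩
    rintro z ⟨hz, hza⟩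
    exact (hsub hz).elim id fun h => hb ⟨h, hza⟩
  rw [isPreconnected_iff_subset_of_disjoint]
  intro U W hU hW hcov hdis
  have hsubset : ball a r \ {a} ⊆ Ω \ {a} := sdiff_subset_sdiff_left hrΩ
  rcases isPreconnected_iff_subset_of_disjoint.1 hball U W hU hW (hsubset.trans hcov)
    (subset_empty_iff.1 ((inter_subset_inter_left _ hsubset).trans hdis.subset)) with h | h
  · exact main U W hU hW hcov hdis h
  · exact (main W U hW hU (by rwa [union_comm]) (by rwa [inter_comm W U]) h).symm

end MaximumPrinciple

section PFunction

variable {n : ℕ} {V Ω : Set (EuclideanSpace ℝ (Fin n))} {u : EuclideanSpace ℝ (Fin n) → ℝ}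
  {x : EuclideanSpace ℝ (Fin n)}

/-- The function `u * P = |Du|² u^{-n/(n-2)}`, which is subharmonic when `u` is harmonic. -/
def Qfun (u : EuclideanSpace ℝ (Fin n) → ℝ) (x : EuclideanSpace ℝ (Fin n)) : ℝ :=
  (∑ i, pd i u x * pd i u x) * u x ^ (-((n : ℝ) / ((n : ℝ) - 2)))

/-- The defect in the `(i, j)` entry of the Hessian identity. -/
def hessDefect (u : EuclideanSpace ℝ (Fin n) → ℝ) (x : EuclideanSpace ℝ (Fin n)) (i j : Fin n) :
    ℝ :=
  u x * pd i (pd j u) x - (n : ℝ) / ((n : ℝ) - 2) * (pd i u x * pd j u x) +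
    (∑ k, pd k u x * pd k u x) / ((n : ℝ) - 2) * (if i = j then 1 else 0)

lemma sum_sq_rank_one_perturbation (H : Fin n → Fin n → ℝ) (p : Fin n → ℝ) (a s c : ℝ) :
    ∑ i, ∑ j, (a * H i j - s * (p i * p j) + c * (if i = j then 1 else 0)) ^ 2 =
      a ^ 2 * ∑ i, ∑ j, H i j ^ 2 + s ^ 2 * (∑ i, p i * p i) ^ 2 + n * c ^ 2
        - 2 * s * a * ∑ i, ∑ j, H i j * (p i * p j) + 2 * a * c * ∑ i, H i i
        - 2 * s * c * ∑ i, p i * p i := by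
  have h : ∀ i j, (a * H i j - s * (p i * p j) + c * (if i = j then 1 else 0)) ^ 2 =
      a ^ 2 * H i j ^ 2 + s ^ 2 * ((p i * p i) * (p j * p j)) -
        2 * s * a * (H i j * (p i * p j)) +
        (if i = j then c ^ 2 + 2 * a * c * H i i - 2 * s * c * (p i * p i) else 0) := by
    intro i j
    split_ifs with hij
    · subst hij; ring
    · ring
  simp only [h, Finset.sum_add_distrib, Finset.sum_sub_distrib, Finset.sum_ite_eq,
    Finset.mem_univ, if_true, ← Finset.mul_sum, ← Finset.sum_mul]
  simp
  ring

lemma contDiffOn_Qfun (hV : IsOpen V) (hu : ContDiffOn ℝ (⊤ : ℕ∞) u V) (h0 : ∀ y ∈ V, 0 < u y) :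
    ContDiffOn ℝ (⊤ : ℕ∞) (Qfun u) V :=
  (ContDiffOn.sum fun i _ => (contDiffOn_pd hV hu i).mul (contDiffOn_pd hV hu i)).mul
    (hu.rpow_const_of_ne fun y hy => (h0 y hy).ne')

lemma lap_pd_eq_zero (hV : IsOpen V) (hu : ContDiffOn ℝ (⊤ : ℕ∞) u V)
    (hl : ∀ y ∈ V, lap u y = 0) (hx : x ∈ V) (j : Fin n) : lap (pd j u) x = 0 := by
  rw [lap_eq_sum_pd hV (contDiffOn_pd hV hu j) hx]
  have h1 : ∀ i, pd i (pd i (pd j u)) x = pd j (pd i (pd i u)) x := fun i => by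
    rw [pd_congr hV (pd_comm hV hu i j) i hx, pd_comm hV (contDiffOn_pd hV hu i) i j hx]
  simp only [h1]
  rw [← pd_sum fun i _ => differentiableAt_of_contDiffOn_top hV
    (contDiffOn_pd hV (contDiffOn_pd hV hu i) i) hx]
  rw [pd_congr hV (g := fun _ => 0) (fun y hy => by
    rw [← hl y hy, lap_eq_sum_pd hV hu hy]) j hx, pd_const]

lemma pd_sum_mul_self (hV : IsOpen V) (hu : ContDiffOn ℝ (⊤ : ℕ∞) u V) (hx : x ∈ V) (i : Fin n) :
    pd i (fun y => ∑ j, pd j u y * pd j u y) x = 2 * ∑ j, pd i (pd j u) x * pd j u x := by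
  have d := fun j => differentiableAt_of_contDiffOn_top hV (contDiffOn_pd hV hu j) hx
  rw [pd_sum fun j _ => (d j).fun_mul (d j), Finset.mul_sum]
  refine Finset.sum_congr rfl fun j _ => ?_
  rw [pd_mul (d j) (d j)]
  ring

lemma pd_Qfun (hV : IsOpen V) (hu : ContDiffOn ℝ (⊤ : ℕ∞) u V) (h0 : ∀ y ∈ V, 0 < u y)
    (hx : x ∈ V) (i : Fin n) :
    pd i (Qfun u) x = (2 * ∑ j, pd i (pd j u) x * pd j u x) * u x ^ (-((n : ℝ) / ((n : ℝ) - 2))) +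
      (∑ j, pd j u x * pd j u x) * (-((n : ℝ) / ((n : ℝ) - 2)) *
        u x ^ (-((n : ℝ) / ((n : ℝ) - 2)) - 1) * pd i u x) := by
  have hS : ContDiffOn ℝ (⊤ : ℕ∞) (fun y => ∑ j, pd j u y * pd j u y) V :=
    ContDiffOn.sum fun i _ => (contDiffOn_pd hV hu i).mul (contDiffOn_pd hV hu i)
  have hr : ContDiffOn ℝ (⊤ : ℕ∞) (fun y => u y ^ (-((n : ℝ) / ((n : ℝ) - 2)))) V :=
    hu.rpow_const_of_ne fun y hy => (h0 y hy).ne'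
  rw [show Qfun u = fun y => (∑ j, pd j u y * pd j u y) * u y ^ (-((n : ℝ) / ((n : ℝ) - 2)))
    from rfl, pd_mul (differentiableAt_of_contDiffOn_top hV hS hx)
      (differentiableAt_of_contDiffOn_top hV hr hx), pd_sum_mul_self hV hu hx,
    pd_rpow (differentiableAt_of_contDiffOn_top hV hu hx) (h0 x hx).ne']

lemma lap_Qfun (hn : 3 ≤ n) (hV : IsOpen V) (hu : ContDiffOn ℝ (⊤ : ℕ∞) u V)
    (h0 : ∀ y ∈ V, 0 < u y) (hl : ∀ y ∈ V, lap u y = 0) (hx : x ∈ V) :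
    lap (Qfun u) x = 2 * u x ^ (-((n : ℝ) / ((n : ℝ) - 2)) - 2) *
      ∑ i, ∑ j, hessDefect u x i j ^ 2 := by
  set s : ℝ := (n : ℝ) / ((n : ℝ) - 2) with hs
  have hux := h0 x hx
  have hS : ContDiffOn ℝ (⊤ : ℕ∞) (fun y => ∑ j, pd j u y * pd j u y) V :=
    ContDiffOn.sum fun i _ => (contDiffOn_pd hV hu i).mul (contDiffOn_pd hV hu i)
  have hr : ContDiffOn ℝ (⊤ : ℕ∞) (fun y => u y ^ (-s)) V :=
    hu.rpow_const_of_ne fun y hy => (h0 y hy).ne'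
  have hlapS : lap (fun y => ∑ j, pd j u y * pd j u y) x =
      2 * ∑ i, ∑ j, pd i (pd j u) x ^ 2 := by
    rw [lap_sum hV (fun j => (contDiffOn_pd hV hu j).mul (contDiffOn_pd hV hu j)) hx,
      Finset.sum_comm, Finset.mul_sum]
    refine Finset.sum_congr rfl fun j _ => ?_
    rw [lap_mul hV (contDiffOn_pd hV hu j) (contDiffOn_pd hV hu j) hx,
      lap_pd_eq_zero hV hu hl hx]
    simp [pow_two]
  have htr : ∑ i, pd i (pd i u) x = 0 := by rw [← lap_eq_sum_pd hV hu hx, hl x hx]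
  have hcross : ∑ i, pd i (fun y => ∑ j, pd j u y * pd j u y) x * pd i (fun y => u y ^ (-s)) x =
      -(2 * s * u x ^ (-s - 1)) * ∑ i, ∑ j, pd i (pd j u) x * (pd i u x * pd j u x) := by
    rw [Finset.mul_sum]
    refine Finset.sum_congr rfl fun i _ => ?_
    rw [pd_sum_mul_self hV hu hx, pd_rpow (differentiableAt_of_contDiffOn_top hV hu hx) hux.ne',
      Finset.mul_sum, Finset.mul_sum, Finset.sum_mul]
    refine Finset.sum_congr rfl fun j _ => ?_
    ring
  have e1 : u x ^ (-s - 1) = u x ^ (-s - 2) * u x := by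
    rw [← Real.rpow_add_one hux.ne']
    congr 1
    ring
  have e2 : u x ^ (-s) = u x ^ (-s - 2) * u x ^ 2 := by
    rw [← Real.rpow_add_natCast hux.ne']
    congr 1
    push_cast
    ring
  have hn2 : (n : ℝ) - 2 ≠ 0 := by
    have : (3 : ℝ) ≤ n := by exact_mod_cast hn
    intro h
    linarith
  simp only [hessDefect, ← hs]
  rw [sum_sq_rank_one_perturbation (fun i j => pd i (pd j u) x) (fun i => pd i u x), htr,
    show Qfun u = fun y => (∑ j, pd j u y * pd j u y) * u y ^ (-s) from rfl,
    lap_mul hV hS hr hx, hlapS, hcross, lap_rpow hV hu h0 hx, hl x hx, e1, e2]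
  simp only [pow_two (pd _ u x)]
  generalize ∑ i, ∑ j, pd i (pd j u) x ^ 2 = a
  generalize ∑ i, ∑ j, pd i (pd j u) x * (pd i u x * pd j u x) = b
  generalize ∑ i, pd i u x * pd i u x = S
  have e3 : s * (-s - 1) * -1 = 2 * (s ^ 2 + n * (1 / ((n : ℝ) - 2)) ^ 2 - 2 * s / (n - 2)) := by
    rw [hs]
    field_simp
    ring
  linear_combination (u x ^ (-s - 2) * S ^ 2) * e3

lemma hessId_of_hessDefect_eq_zero (hV : IsOpen V) (hu : ContDiffOn ℝ (⊤ : ℕ∞) u V)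
    (hx : x ∈ V) (h : ∀ i j, hessDefect u x i j = 0) : HessId u x := by
  intro v w
  rw [hess2_eq_sum_pd hV hu hx, inner_gradient_eq, inner_gradient_eq, norm_gradient_sq,
    fderiv_eq_sum_pd, fderiv_eq_sum_pd, PiLp.inner_apply, Finset.sum_mul_sum, Finset.mul_sum,
    Finset.mul_sum, Finset.mul_sum, ← Finset.sum_sub_distrib]
  refine Finset.sum_congr rfl fun i _ => ?_
  have hi : inner ℝ (v i) (w i) = ∑ j, v i * w j * (if i = j then 1 else 0) := by
    simp [mul_comm]
  rw [hi, Finset.mul_sum, Finset.mul_sum, Finset.mul_sum, ← Finset.sum_sub_distrib]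
  refine Finset.sum_congr rfl fun j _ => ?_
  have := h i j
  simp only [hessDefect] at this
  simp only [pow_two]
  linear_combination (v i * w j) * this

lemma Pfun_mul_self (hn : 3 ≤ n) (h0 : 0 < u x) : Pfun u x * u x = Qfun u x := by
  have hn2 : (n : ℝ) - 2 ≠ 0 := by
    have : (3 : ℝ) ≤ n := by exact_mod_cast hn
    intro h
    linarith
  rw [Pfun, Qfun, norm_gradient_sq, div_eq_mul_inv, ← Real.rpow_neg h0.le, mul_assoc,
    ← Real.rpow_add_one h0.ne']
  simp only [pow_two]
  congr 2
  field_simp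
  ring

lemma sum_pd_mul_pd_Qfun (hV : IsOpen V) (hu : ContDiffOn ℝ (⊤ : ℕ∞) u V)
    (h0 : ∀ y ∈ V, 0 < u y) (hx : x ∈ V) :
    ∑ i, pd i u x * pd i (Qfun u) x =
      2 * hess2 u x (gradient u x) (gradient u x) * u x ^ (-((n : ℝ) / ((n : ℝ) - 2))) -
        (n : ℝ) / ((n : ℝ) - 2) * (‖gradient u x‖ ^ 2) ^ 2 *
          u x ^ (-((n : ℝ) / ((n : ℝ) - 2)) - 1) := by
  rw [hess2_eq_sum_pd hV hu hx, norm_gradient_sq]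
  simp only [pd_Qfun hV hu h0 hx, gradient_apply, mul_add, Finset.sum_add_distrib]
  rw [sub_eq_add_neg]
  congr 1
  · rw [Finset.mul_sum, Finset.sum_mul]
    refine Finset.sum_congr rfl fun i _ => ?_
    rw [Finset.mul_sum, Finset.mul_sum, Finset.sum_mul, Finset.sum_mul, Finset.mul_sum]
    refine Finset.sum_congr rfl fun j _ => ?_
    ring
  · simp only [pow_two (pd _ u x)]
    rw [pow_two, mul_assoc, mul_assoc, Finset.sum_mul, Finset.mul_sum, ← Finset.sum_neg_distrib]
    refine Finset.sum_congr rfl fun i _ => ?_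
    ring

end PFunction

section Boundary

variable {n : ℕ} {V Ω : Set (EuclideanSpace ℝ (Fin n))} {u v q : EuclideanSpace ℝ (Fin n) → ℝ}
  {x p : EuclideanSpace ℝ (Fin n)}

lemma hasDerivAt_add_smul (hV : IsOpen V) (hu : ContDiffOn ℝ (⊤ : ℕ∞) u V) {t : ℝ}
    (hx : x + t • p ∈ V) :
    HasDerivAt (fun t : ℝ => u (x + t • p)) (fderiv ℝ u (x + t • p) p) t := by
  have hline : HasDerivAt (fun t : ℝ => x + t • p) p t := by
    simpa using ((hasDerivAt_id t).smul_const p).const_add x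
  exact (differentiableAt_of_contDiffOn_top hV hu hx).hasFDerivAt.comp_hasDerivAt t hline

/-- At a boundary point where `u` is constant on the boundary, larger inside, and increasing in the
direction `p`, the vector `p` points inside. -/
lemma eventually_add_smul_mem (hΩ : IsOpen Ω) (hV : IsOpen V) (hu : ContDiffOn ℝ (⊤ : ℕ∞) u V)
    {c : ℝ} (hc : ∀ y ∈ frontier Ω, u y = c) (hx : x ∈ frontier Ω) (hxV : x ∈ V)
    (hgt : ∀ᶠ y in 𝓝 x, y ∈ Ω → c < u y) (hp : 0 < fderiv ℝ u x p) :
    ∀ᶠ t in 𝓝[>] (0 : ℝ), x + t • p ∈ Ω := by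
  have hcont : ContinuousAt (fun y => fderiv ℝ u y p) x :=
    (((hu.fderiv_of_isOpen hV (m := (⊤ : ℕ∞)) (by norm_cast)).clm_apply
      contDiffOn_const).continuousOn).continuousAt (hV.mem_nhds hxV)
  obtain ⟨ρ, hρ, hball⟩ := Metric.eventually_nhds_iff.1
    ((hcont.eventually (lt_mem_nhds hp)).and (hgt.and (hV.mem_nhds hxV)))
  have hsmall : ∀ᶠ t in 𝓝[>] (0 : ℝ), t * ‖p‖ < ρ / 2 := by
    refine Filter.Eventually.filter_mono nhdsWithin_le_nhds ?_
    have : Tendsto (fun t : ℝ => t * ‖p‖) (𝓝 0) (𝓝 (0 * ‖p‖)) :=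
      tendsto_id.mul_const _
    rw [zero_mul] at this
    exact this.eventually (gt_mem_nhds (half_pos hρ))
  filter_upwards [hsmall, self_mem_nhdsWithin] with t ht ht0
  have ht0' : 0 < t := ht0
  have hmem : ∀ y, dist y x < ρ / 2 → ∀ τ ∈ Icc 0 t, dist (y + τ • p) x < ρ := by
    intro y hy τ hτ
    have h1 : dist (y + τ • p) x ≤ dist y x + ‖τ • p‖ := by
      rw [dist_eq_norm, dist_eq_norm, add_sub_right_comm]
      exact norm_add_le _ _
    rw [norm_smul, Real.norm_of_nonneg hτ.1] at h1
    have h2 : τ * ‖p‖ ≤ t * ‖p‖ := mul_le_mul_of_nonneg_right hτ.2 (norm_nonneg _)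
    linarith
  have hmono : ∀ y, dist y x < ρ / 2 → StrictMonoOn (fun τ : ℝ => u (y + τ • p)) (Icc 0 t) := by
    intro y hy
    have hd : ∀ τ ∈ Icc 0 t,
        HasDerivAt (fun τ : ℝ => u (y + τ • p)) (fderiv ℝ u (y + τ • p) p) τ :=
      fun τ hτ => hasDerivAt_add_smul hV hu (hball (hmem y hy τ hτ)).2.2
    refine strictMonoOn_of_deriv_pos (convex_Icc 0 t)
      (fun τ hτ => (hd τ hτ).continuousAt.continuousWithinAt) fun τ hτ => ?_
    have hτ' := interior_subset hτ
    rw [(hd τ hτ').deriv]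
    exact (hball (hmem y hy τ hτ')).1
  have hxx : dist x x < ρ / 2 := by simpa using hρ
  have htI : t ∈ Icc 0 t := ⟨ht0'.le, le_rfl⟩
  have h0I : (0 : ℝ) ∈ Icc 0 t := ⟨le_rfl, ht0'.le⟩
  have hz : c < u (x + t • p) := by
    have := hmono x hxx h0I htI ht0'
    simpa [hc x hx] using this
  have hzV : x + t • p ∈ V := (hball (hmem x hxx t htI)).2.2
  obtain ⟨σ, hσ, hσu⟩ := Metric.eventually_nhds_iff.1
    ((hu.continuousOn.continuousAt (hV.mem_nhds hzV)).eventually (lt_mem_nhds hz))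
  obtain ⟨y, hyΩ, hyx⟩ := Metric.mem_closure_iff.1 (frontier_subset_closure hx)
    (min σ (ρ / 2)) (lt_min hσ (half_pos hρ))
  rw [dist_comm] at hyx
  have hyρ : dist y x < ρ / 2 := hyx.trans_le (min_le_right _ _)
  have hyu : c < u y := (hball (hyρ.trans (half_lt_self hρ))).2.1 hyΩ
  set S : Set (EuclideanSpace ℝ (Fin n)) :=
    (fun τ : ℝ => y + τ • p) '' Icc 0 t ∪ ball (x + t • p) σ with hS
  have hSu : ∀ z ∈ S, c < u z := by
    rintro z (⟨τ, hτ, rfl⟩ | hz)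
    · have := (hmono y hyρ).monotoneOn h0I hτ hτ.1
      simp only [zero_smul, add_zero] at this
      exact hyu.trans_le this
    · exact hσu hz
  have hSp : IsPreconnected S := by
    refine IsPreconnected.union (y + t • p) ⟨t, htI, rfl⟩ ?_
      (isPreconnected_Icc.image _ (by fun_prop)) isPreconnected_ball
    rw [mem_ball, dist_add_right]
    exact hyx.trans_le (min_le_left _ _)
  have hSΩ : S ⊆ Ω := by
    refine hSp.subset_of_closure_inter_subset hΩ ⟨y, Or.inl ⟨0, h0I, by simp⟩, hyΩ⟩ ?_
    rintro z ⟨hz, hzS⟩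
    by_contra hzΩ
    have : z ∈ frontier Ω := by rw [hΩ.frontier_eq]; exact ⟨hz, hzΩ⟩
    exact (hSu z hzS).ne' (hc z this)
  exact hSΩ (Or.inr (mem_ball_self hσ))

lemma fderiv_nonneg_of_eventually_nonneg (hV : IsOpen V) (hq : ContDiffOn ℝ (⊤ : ℕ∞) q V)
    (hx : x ∈ V) (h0 : q x = 0) (h : ∀ᶠ t in 𝓝[>] (0 : ℝ), 0 ≤ q (x + t • p)) :
    0 ≤ fderiv ℝ q x p := by
  have hd : HasDerivAt (fun t : ℝ => q (x + t • p)) (fderiv ℝ q x p) 0 := by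
    simpa using hasDerivAt_add_smul (t := 0) (p := p) hV hq (by simpa using hx)
  have := (hasDerivWithinAt_iff_tendsto_slope' self_notMem_Ioi).1
    (hd.hasDerivWithinAt (s := Ioi 0))
  refine ge_of_tendsto this ?_
  filter_upwards [h, self_mem_nhdsWithin] with t ht ht0
  have ht0' : 0 < t := ht0
  rw [slope_def_field]
  simp only [zero_smul, add_zero, h0, sub_zero]
  positivity

lemma norm_gradient_eq : ‖gradient u x‖ = ‖fderiv ℝ u x‖ := by
  simp [gradient]

lemma norm_fderiv_norm_rpow_two_sub_le (hn : 3 ≤ n) (hx : x ≠ 0) :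
    DifferentiableAt ℝ (fun y : EuclideanSpace ℝ (Fin n) => ‖y‖ ^ ((2 : ℝ) - n)) x ∧
    ‖fderiv ℝ (fun y : EuclideanSpace ℝ (Fin n) => ‖y‖ ^ ((2 : ℝ) - n)) x‖ ≤
      n * ‖x‖ ^ ((1 : ℝ) - n) := by
  have hnR : (3 : ℝ) ≤ n := by exact_mod_cast hn
  have hx0 : 0 < ‖x‖ := norm_pos_iff.2 hx
  have hfun : (fun y : EuclideanSpace ℝ (Fin n) => ‖y‖ ^ ((2 : ℝ) - n)) =
      fun y => (‖y‖ ^ 2) ^ (1 - (n : ℝ) / 2) := by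
    funext y
    rw [← Real.rpow_natCast, ← Real.rpow_mul (norm_nonneg _)]
    congr 1
    push_cast
    ring
  have h : HasFDerivAt (fun y : EuclideanSpace ℝ (Fin n) => ‖y‖ ^ 2) _ x :=
    (hasFDerivAt_id x).norm_sq
  have h2 := h.rpow_const (p := 1 - (n : ℝ) / 2) (Or.inl (by positivity))
  rw [hfun]
  refine ⟨h2.differentiableAt, ?_⟩
  rw [h2.fderiv, norm_smul]
  have e1 : ‖2 • (innerSL ℝ (id x)).comp (ContinuousLinearMap.id ℝ (EuclideanSpace ℝ (Fin n)))‖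
      ≤ 2 * ‖x‖ := by
    refine (norm_nsmul_le).trans ?_
    simp
  have e2 : ‖(1 - (n : ℝ) / 2) * (‖x‖ ^ 2) ^ (1 - (n : ℝ) / 2 - 1)‖ ≤
      n / 2 * ‖x‖ ^ (-(n : ℝ)) := by
    rw [norm_mul, ← Real.rpow_natCast ‖x‖ 2, ← Real.rpow_mul (norm_nonneg _),
      Real.norm_of_nonneg (r := ‖x‖ ^ _) (by positivity)]
    refine mul_le_mul ?_ (le_of_eq ?_) (by positivity) (by positivity)
    · rw [Real.norm_eq_abs, abs_le]
      constructor <;> linarith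
    · congr 1
      push_cast
      ring
  refine (mul_le_mul e2 e1 (norm_nonneg _) (by positivity)).trans (le_of_eq ?_)
  rw [show (1 : ℝ) - n = -n + 1 by ring, Real.rpow_add_one hx0.ne']
  ring

/-- Near the pole `u` is large and its `P`-function is bounded. -/
lemma exists_lt_and_Pfun_le_near_pole (hn : 3 ≤ n) (hΩ : IsOpen Ω)
    (h0 : (0 : EuclideanSpace ℝ (Fin n)) ∈ Ω) {A : ℝ} (hA : 0 < A) (b : ℝ)
    (hv : ContDiffOn ℝ (⊤ : ℕ∞) v Ω)
    (huv : ∀ x ∈ Ω \ {(0 : EuclideanSpace ℝ (Fin n))}, u x = A * ‖x‖ ^ ((2 : ℝ) - n) + v x) :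
    ∃ r > 0, closedBall 0 r ⊆ Ω ∧ ∃ C, ∀ x, x ≠ 0 → ‖x‖ ≤ r → b < u x ∧ Pfun u x ≤ C := by
  have hnR : (3 : ℝ) ≤ n := by exact_mod_cast hn
  obtain ⟨R, hR, hRΩ⟩ := Metric.nhds_basis_closedBall.mem_iff.1 (hΩ.mem_nhds h0)
  obtain ⟨K₁, hK₁⟩ := (isCompact_closedBall (0 : EuclideanSpace ℝ (Fin n)) R).exists_bound_of_continuousOn
    (hv.continuousOn.mono hRΩ)
  obtain ⟨K₂, hK₂⟩ := (isCompact_closedBall (0 : EuclideanSpace ℝ (Fin n)) R).exists_bound_of_continuousOn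
    ((hv.fderiv_of_isOpen hΩ (m := (⊤ : ℕ∞)) (by norm_cast)).continuousOn.mono hRΩ)
  have hK₂0 : 0 ≤ K₂ := (norm_nonneg _).trans (hK₂ 0 (mem_closedBall_self hR.le))
  have hK₁0 : 0 ≤ K₁ := (norm_nonneg _).trans (hK₁ 0 (mem_closedBall_self hR.le))
  set B := A / (2 * (K₁ + |b| + 1)) with hB
  have hB0 : 0 < B := by positivity
  set r := min R (min 1 B) with hr
  have hr0 : 0 < r := lt_min hR (lt_min one_pos hB0)
  refine ⟨r, hr0, (closedBall_subset_closedBall (min_le_left _ _)).trans hRΩ,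
    (A * n + K₂) ^ 2 / (A / 2) ^ (2 * ((n : ℝ) - 1) / ((n : ℝ) - 2)), fun x hx0 hxr => ?_⟩
  have hxpos : 0 < ‖x‖ := norm_pos_iff.2 hx0
  have hxR : x ∈ closedBall (0 : EuclideanSpace ℝ (Fin n)) R := by
    simpa using hxr.trans (min_le_left _ _)
  have hx1 : ‖x‖ ≤ 1 := hxr.trans ((min_le_right _ _).trans (min_le_left _ _))
  have hxB : ‖x‖ ≤ B := hxr.trans ((min_le_right _ _).trans (min_le_right _ _))
  have hxΩ : x ∈ Ω \ {(0 : EuclideanSpace ℝ (Fin n))} := ⟨hRΩ hxR, hx0⟩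
  have hpow : B⁻¹ ≤ ‖x‖ ^ ((2 : ℝ) - n) := by
    calc B⁻¹ ≤ ‖x‖⁻¹ := inv_anti₀ hxpos hxB
      _ = ‖x‖ ^ (-1 : ℝ) := (Real.rpow_neg_one _).symm
      _ ≤ ‖x‖ ^ ((2 : ℝ) - n) :=
        Real.rpow_le_rpow_of_exponent_ge hxpos hx1 (by linarith)
  have hlarge : K₁ + |b| + 1 ≤ A / 2 * ‖x‖ ^ ((2 : ℝ) - n) := by
    refine le_trans (le_of_eq ?_) (mul_le_mul_of_nonneg_left hpow (by positivity))
    rw [hB]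
    field_simp
  have hvx := hK₁ x hxR
  rw [Real.norm_eq_abs, abs_le] at hvx
  have hux := huv x hxΩ
  have hlow : A / 2 * ‖x‖ ^ ((2 : ℝ) - n) + |b| + 1 ≤ u x := by
    rw [hux]
    linarith [hvx.1]
  have hpow0 : 0 < ‖x‖ ^ ((2 : ℝ) - n) := Real.rpow_pos_of_pos hxpos _
  refine ⟨?_, ?_⟩
  · have := le_abs_self b
    have := mul_pos (half_pos hA) hpow0
    linarith
  have hgrad : ‖gradient u x‖ ≤ (A * n + K₂) * ‖x‖ ^ ((1 : ℝ) - n) := by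
    have hEq : u =ᶠ[𝓝 x] fun y => A * ‖y‖ ^ ((2 : ℝ) - n) + v y :=
      (show EqOn u (fun y => A * ‖y‖ ^ ((2 : ℝ) - n) + v y) (Ω \ {0}) from huv).eventuallyEq_of_mem
        ((hΩ.sdiff isClosed_singleton).mem_nhds hxΩ)
    obtain ⟨hd, hle⟩ := norm_fderiv_norm_rpow_two_sub_le hn hx0
    have hone : 1 ≤ ‖x‖ ^ ((1 : ℝ) - n) :=
      Real.one_le_rpow_of_pos_of_le_one_of_nonpos hxpos hx1 (by linarith)
    rw [norm_gradient_eq, hEq.fderiv_eq, fderiv_fun_add (hd.const_mul A)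
      (differentiableAt_of_contDiffOn_top hΩ hv hxΩ.1), fderiv_const_mul hd]
    refine (norm_add_le _ _).trans ?_
    rw [norm_smul, Real.norm_of_nonneg hA.le]
    nlinarith [hK₂ x hxR, mul_le_mul_of_nonneg_left hle hA.le,
      mul_le_mul_of_nonneg_left hone hK₂0]
  have hupow : (A / 2 * ‖x‖ ^ ((2 : ℝ) - n)) ^ (2 * ((n : ℝ) - 1) / ((n : ℝ) - 2)) ≤
      u x ^ (2 * ((n : ℝ) - 1) / ((n : ℝ) - 2)) := by
    refine Real.rpow_le_rpow (by positivity) ?_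
      (div_nonneg (by linarith) (by linarith))
    have := abs_nonneg b
    linarith
  have hsplit : (A / 2 * ‖x‖ ^ ((2 : ℝ) - n)) ^ (2 * ((n : ℝ) - 1) / ((n : ℝ) - 2)) =
      (A / 2) ^ (2 * ((n : ℝ) - 1) / ((n : ℝ) - 2)) * (‖x‖ ^ ((1 : ℝ) - n)) ^ 2 := by
    rw [Real.mul_rpow (by positivity) hpow0.le, ← Real.rpow_mul hxpos.le,
      ← Real.rpow_natCast (‖x‖ ^ ((1 : ℝ) - n)) 2, ← Real.rpow_mul hxpos.le]
    congr 2
    have : (n : ℝ) - 2 ≠ 0 := by linarith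
    field_simp
    push_cast
    ring
  have hone0 : 0 < ‖x‖ ^ ((1 : ℝ) - n) := Real.rpow_pos_of_pos hxpos _
  rw [Pfun]
  calc ‖gradient u x‖ ^ 2 / u x ^ (2 * ((n : ℝ) - 1) / ((n : ℝ) - 2))
      ≤ ((A * n + K₂) * ‖x‖ ^ ((1 : ℝ) - n)) ^ 2 /
        ((A / 2) ^ (2 * ((n : ℝ) - 1) / ((n : ℝ) - 2)) * (‖x‖ ^ ((1 : ℝ) - n)) ^ 2) :=
        div_le_div₀ (by positivity) (pow_le_pow_left₀ (norm_nonneg _) hgrad 2) (by positivity)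
          (hsplit ▸ hupow)
    _ = (A * n + K₂) ^ 2 / (A / 2) ^ (2 * ((n : ℝ) - 1) / ((n : ℝ) - 2)) := by
        field_simp

end Boundary

section Rigidity

variable {n : ℕ} {V Ω : Set (EuclideanSpace ℝ (Fin n))} {u v f g : EuclideanSpace ℝ (Fin n) → ℝ}
  {x : EuclideanSpace ℝ (Fin n)}

lemma contDiffOn_linear_combination (hf : ContDiffOn ℝ (⊤ : ℕ∞) f V)
    (hg : ContDiffOn ℝ (⊤ : ℕ∞) g V) (a b k : ℝ) :
    ContDiffOn ℝ (⊤ : ℕ∞) (fun y => a * f y + b * g y + k) V :=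
  ((contDiffOn_const.mul hf).add (contDiffOn_const.mul hg)).add contDiffOn_const

lemma lap_linear_combination (hV : IsOpen V) (hf : ContDiffOn ℝ (⊤ : ℕ∞) f V)
    (hg : ContDiffOn ℝ (⊤ : ℕ∞) g V) (hx : x ∈ V) (a b k : ℝ) :
    lap (fun y => a * f y + b * g y + k) x = a * lap f x + b * lap g x := by
  rw [lap_add hV ((contDiffOn_const.mul hf).add (contDiffOn_const.mul hg)) contDiffOn_const hx,
    lap_add hV (contDiffOn_const.mul hf) (contDiffOn_const.mul hg) hx, lap_const_mul hV hf hx,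
    lap_const_mul hV hg hx, lap_const, add_zero]

lemma hessId_of_eqOn_const (hV : IsOpen V) {c : ℝ} (h : ∀ y ∈ V, u y = c) (hx : x ∈ V) :
    HessId u x := by
  have hE : u =ᶠ[𝓝 x] fun _ => c := eventuallyEq_of_mem (hV.mem_nhds hx) h
  have hg : gradient u x = 0 := by
    rw [gradient, hE.fderiv_eq]
    simp
  have hh : ∀ v w, hess2 u x v w = 0 := fun v w => by
    have : fderiv ℝ u =ᶠ[𝓝 x] fun _ => 0 := hE.fderiv.trans (by simp [Pi.zero_def])
    rw [hess2_apply, this.fderiv_eq]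
    simp
  intro v w
  simp [hg, hh]

lemma hessId_of_lap_Qfun_eq_zero (hn : 3 ≤ n) (hV : IsOpen V) (hu : ContDiffOn ℝ (⊤ : ℕ∞) u V)
    (h0 : ∀ y ∈ V, 0 < u y) (hl : ∀ y ∈ V, lap u y = 0) (hx : x ∈ V)
    (hQ : lap (Qfun u) x = 0) : HessId u x := by
  rw [lap_Qfun hn hV hu h0 hl hx] at hQ
  have hpos : 0 < 2 * u x ^ (-((n : ℝ) / ((n : ℝ) - 2)) - 2) :=
    mul_pos two_pos (Real.rpow_pos_of_pos (h0 x hx) _)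
  have hsum := (mul_eq_zero.1 hQ).resolve_left hpos.ne'
  refine hessId_of_hessDefect_eq_zero hV hu hx fun i j => ?_
  rw [Finset.sum_eq_zero_iff_of_nonneg
    fun i _ => Finset.sum_nonneg fun j _ => sq_nonneg _] at hsum
  have := (Finset.sum_eq_zero_iff_of_nonneg fun j _ => sq_nonneg _).1
    (hsum i (Finset.mem_univ i)) j (Finset.mem_univ j)
  exact pow_eq_zero_iff two_ne_zero |>.1 this

lemma lap_Qfun_nonneg (hn : 3 ≤ n) (hV : IsOpen V) (hu : ContDiffOn ℝ (⊤ : ℕ∞) u V)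
    (h0 : ∀ y ∈ V, 0 < u y) (hl : ∀ y ∈ V, lap u y = 0) (hx : x ∈ V) : 0 ≤ lap (Qfun u) x := by
  rw [lap_Qfun hn hV hu h0 hl hx]
  exact mul_nonneg (mul_nonneg zero_le_two (Real.rpow_nonneg (h0 x hx).le _))
    (Finset.sum_nonneg fun i _ => Finset.sum_nonneg fun j _ => sq_nonneg _)

/-- A solution without singularity at the origin is constant. -/
lemma eq_of_removable (hn : 0 < n) (hΩ : IsOpen Ω) (hb : Bornology.IsBounded Ω)
    (h0 : (0 : EuclideanSpace ℝ (Fin n)) ∈ Ω) {c : ℝ}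
    (hc : ContinuousOn u (closure Ω \ {0})) (hv : ContDiffOn ℝ (⊤ : ℕ∞) v Ω)
    (hl : ∀ x ∈ Ω, lap v x = 0) (huv : ∀ x ∈ Ω \ {(0 : EuclideanSpace ℝ (Fin n))}, u x = v x)
    (hfr : ∀ x ∈ frontier Ω, u x = c) :
    ∀ x ∈ Ω \ {(0 : EuclideanSpace ℝ (Fin n))}, u x = c := by
  classical
  set g : EuclideanSpace ℝ (Fin n) → ℝ := Function.update u 0 (v 0) with hg
  have hne : ∀ x, x ≠ 0 → g x = u x := fun x hx => Function.update_of_ne hx _ _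
  have hgv : EqOn g v Ω := by
    intro x hx
    by_cases hx0 : x = 0
    · subst hx0
      simp [hg]
    · rw [hne x hx0, huv x ⟨hx, hx0⟩]
  have hgs : ContDiffOn ℝ (⊤ : ℕ∞) g Ω := hv.congr hgv
  have hgl : ∀ x ∈ Ω, lap g x = 0 := fun x hx => by rw [lap_congr hΩ hgv hx, hl x hx]
  have hfr0 : ∀ x ∈ frontier Ω, x ≠ 0 := by
    rintro x hx rfl
    rw [hΩ.frontier_eq] at hx
    exact hx.2 h0
  have hgc : ContinuousOn g (closure Ω) := by
    intro x hx
    by_cases hxΩ : x ∈ Ω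
    · exact (hgs.continuousOn.continuousAt (hΩ.mem_nhds hxΩ)).continuousWithinAt
    have hx0 : x ≠ 0 := fun h => hxΩ (h ▸ h0)
    have h1 : ContinuousWithinAt u (closure Ω) x :=
      (hc x ⟨hx, hx0⟩).mono_of_mem_nhdsWithin
        (inter_mem_nhdsWithin _ (isOpen_compl_singleton.mem_nhds hx0))
    exact h1.congr_of_eventuallyEq
      (mem_nhdsWithin_of_mem_nhds
        (mem_of_superset (isOpen_compl_singleton.mem_nhds hx0) hne)) (hne x hx0)
  have key : ∀ a k : ℝ, (a * c + k = 0) → ∀ x ∈ Ω, 0 ≤ a * g x + 0 * g x + k := by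
    intro a k hak
    refine nonneg_of_lap_nonpos hn hΩ hb
      (((continuousOn_const.mul hgc).add (continuousOn_const.mul hgc)).add continuousOn_const)
      (contDiffOn_linear_combination hgs hgs a 0 k) (fun x hx => ?_) fun x hx => ?_
    · rw [lap_linear_combination hΩ hgs hgs hx, hgl x hx]
      simp
    · rw [hne x (hfr0 x hx), hfr x hx]
      linarith
  intro x hx
  have h1 := key 1 (-c) (by ring) x hx.1
  have h2 := key (-1) c (by ring) x hx.1
  rw [hne x hx.2] at h1 h2
  linarith

/-- Nonnegativity of `H/(n-1) - |Du|/((n-2)u)` bounds the derivative of `Qfun u` along the gradient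
from below. -/
lemma mul_norm_gradient_sq_le_of_bracket_nonneg (hn : 3 ≤ n) (hV : IsOpen V)
    (hu : ContDiffOn ℝ (⊤ : ℕ∞) u V) (h0 : ∀ y ∈ V, 0 < u y) (hx : x ∈ V) {M : ℝ}
    (hM : Qfun u x = M * u x) (hg : 0 < ‖gradient u x‖)
    (hbr : 0 ≤ meanH u x / ((n : ℝ) - 1) - ‖gradient u x‖ / (((n : ℝ) - 2) * u x)) :
    M * ‖gradient u x‖ ^ 2 ≤ ∑ i, pd i u x * pd i (Qfun u) x := by
  have hnR : (3 : ℝ) ≤ n := by exact_mod_cast hn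
  have hn1 : 0 < (n : ℝ) - 1 := by linarith
  have hn2 : 0 < (n : ℝ) - 2 := by linarith
  have hux := h0 x hx
  rw [sum_pd_mul_pd_Qfun hV hu h0 hx]
  set s := (n : ℝ) / ((n : ℝ) - 2) with hs
  set G := ‖gradient u x‖ with hG
  set h := hess2 u x (gradient u x) (gradient u x) with hh
  set E := u x ^ (-s - 1) with hE
  have hE0 : 0 < E := Real.rpow_pos_of_pos hux _
  have hEs : u x ^ (-s) = E * u x := by
    rw [hE, ← Real.rpow_add_one hux.ne']
    congr 1
    ring
  have hQ : Qfun u x = G ^ 2 * (E * u x) := by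
    rw [Qfun, ← hs, hEs, hG, norm_gradient_sq]
    simp only [pow_two]
  have hMe : M = G ^ 2 * E := by
    rw [hQ] at hM
    have : (G ^ 2 * E) * u x = M * u x := by rw [← hM]; ring
    exact (mul_right_cancel₀ hux.ne' this).symm
  have hb : (1 + s) * G ^ 4 ≤ 2 * h * u x := by
    have h1 : G / (((n : ℝ) - 2) * u x) ≤ h / G ^ 3 / ((n : ℝ) - 1) := by
      have : meanH u x = h / G ^ 3 := rfl
      rw [← this]
      linarith
    rw [div_div, div_le_div_iff₀ (by positivity) (by positivity)] at h1
    have hs1 : (1 + s) * ((n : ℝ) - 2) = 2 * ((n : ℝ) - 1) := by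
      rw [hs]
      field_simp
      ring
    refine le_of_mul_le_mul_right ?_ hn2
    calc (1 + s) * G ^ 4 * ((n : ℝ) - 2) = 2 * (G * (G ^ 3 * ((n : ℝ) - 1))) := by
          rw [mul_right_comm, hs1]; ring
      _ ≤ 2 * (h * (((n : ℝ) - 2) * u x)) := by linarith
      _ = 2 * h * u x * ((n : ℝ) - 2) := by ring
  rw [hEs, hMe]
  nlinarith [mul_le_mul_of_nonneg_right hb hE0.le]

/-- The solution exceeds its boundary value. -/
lemma lt_of_pole (hn : 3 ≤ n) (hΩ : IsOpen Ω) (hp : IsPreconnected Ω)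
    (hb : Bornology.IsBounded Ω) {c r : ℝ} (hr : 0 < r) (hrΩ : closedBall 0 r ⊆ Ω)
    (hc : ContinuousOn u (closure Ω \ {0})) (hu : ContDiffOn ℝ (⊤ : ℕ∞) u (Ω \ {0}))
    (hl : ∀ x ∈ Ω \ {(0 : EuclideanSpace ℝ (Fin n))}, lap u x = 0)
    (hfr : ∀ x ∈ frontier Ω, u x = c) (hpole : ∀ x, x ≠ 0 → ‖x‖ ≤ r → c < u x) :
    ∀ x ∈ Ω \ {(0 : EuclideanSpace ℝ (Fin n))}, c < u x := by
  have hVo : IsOpen (Ω \ {(0 : EuclideanSpace ℝ (Fin n))}) := hΩ.sdiff isClosed_singleton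
  have hfs := contDiffOn_linear_combination hu hu 1 0 (-c)
  have hfl : ∀ x ∈ Ω \ {(0 : EuclideanSpace ℝ (Fin n))},
      lap (fun y => 1 * u y + 0 * u y + -c) x ≤ 0 := fun x hx => by
    rw [lap_linear_combination hVo hu hu hx, hl x hx]
    simp
  have hnonneg : ∀ x ∈ Ω \ {(0 : EuclideanSpace ℝ (Fin n))}, 0 ≤ 1 * u x + 0 * u x + -c := by
    intro x hx
    rcases le_or_gt ‖x‖ r with h | h
    · linarith [hpole x hx.2 h]
    refine nonneg_of_lap_nonpos_of_sphere (f := fun y => 1 * u y + 0 * u y + -c) (by omega) hΩ hb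
      (((continuousOn_const.mul hc).add (continuousOn_const.mul hc)).add continuousOn_const)
      hfs hfl (fun y hy => by rw [hfr y hy]; linarith) hr (fun y _ hy => ?_) x hx.1 h
    linarith [hpole y (norm_pos_iff.1 (hy ▸ hr)) hy.le]
  have : Nontrivial (EuclideanSpace ℝ (Fin n)) := by
    have : Nonempty (Fin n) := ⟨⟨0, by omega⟩⟩
    infer_instance
  obtain ⟨y, hy⟩ := (NormedSpace.sphere_nonempty (x := (0 : EuclideanSpace ℝ (Fin n)))).2 hr.le
  have hyr : ‖y‖ = r := by simpa using hy
  have hy0 : y ≠ 0 := norm_pos_iff.1 (hyr ▸ hr)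
  intro x hx
  have := pos_of_lap_nonpos_of_isPreconnected hVo (by omega)
    (isPreconnected_diff_singleton (by omega) hΩ hp 0) hfs hfl hnonneg
    (y := y) ⟨hrΩ (by simp [hyr]), hy0⟩ (by linarith [hpole y hy0 hyr.le]) x hx
  linarith

/-- A nonnegative supersolution which vanishes on the boundary and is positive inside dominates a
multiple of `u - c`. -/
lemma exists_mul_sub_le (hn : 3 ≤ n) (hΩ : IsOpen Ω) (hb : Bornology.IsBounded Ω) {c r : ℝ}
    (hr : 0 < r) (hrΩ : closedBall 0 r ⊆ Ω) {w : EuclideanSpace ℝ (Fin n) → ℝ}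
    (huc : ContinuousOn u (closure Ω \ {0})) (hwc : ContinuousOn w (closure Ω \ {0}))
    (hu : ContDiffOn ℝ (⊤ : ℕ∞) u (Ω \ {0})) (hw : ContDiffOn ℝ (⊤ : ℕ∞) w (Ω \ {0}))
    (hul : ∀ x ∈ Ω \ {(0 : EuclideanSpace ℝ (Fin n))}, lap u x = 0)
    (hwl : ∀ x ∈ Ω \ {(0 : EuclideanSpace ℝ (Fin n))}, lap w x ≤ 0)
    (hufr : ∀ x ∈ frontier Ω, u x = c) (hwfr : ∀ x ∈ frontier Ω, w x = 0)
    (hcu : ∀ x ∈ Ω \ {(0 : EuclideanSpace ℝ (Fin n))}, c < u x)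
    (hw0 : ∀ x ∈ Ω \ {(0 : EuclideanSpace ℝ (Fin n))}, 0 < w x) :
    ∃ ε > 0, ∀ x ∈ Ω, r < ‖x‖ → ε * (u x - c) ≤ w x := by
  have hVo : IsOpen (Ω \ {(0 : EuclideanSpace ℝ (Fin n))}) := hΩ.sdiff isClosed_singleton
  have : Nontrivial (EuclideanSpace ℝ (Fin n)) := by
    have : Nonempty (Fin n) := ⟨⟨0, by omega⟩⟩
    infer_instance
  have hsub : sphere (0 : EuclideanSpace ℝ (Fin n)) r ⊆ Ω \ {0} := fun y hy =>
    ⟨hrΩ (sphere_subset_closedBall hy), ne_of_mem_sphere hy hr.ne'⟩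
  obtain ⟨z, hz, hmin⟩ := (isCompact_sphere (0 : EuclideanSpace ℝ (Fin n)) r).exists_isMinOn
    (NormedSpace.sphere_nonempty.2 hr.le)
    (ContinuousOn.div (hw.continuousOn.mono hsub)
      ((hu.continuousOn.mono hsub).sub continuousOn_const)
      fun y hy => (sub_pos.2 (hcu y (hsub hy))).ne')
  set ε := w z / (u z - c) with hε
  refine ⟨ε, div_pos (hw0 z (hsub hz)) (sub_pos.2 (hcu z (hsub hz))), fun x hx hxr => ?_⟩
  have := nonneg_of_lap_nonpos_of_sphere (f := fun y => 1 * w y + -ε * u y + ε * c) (by omega) hΩ hb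
    (((continuousOn_const.mul hwc).add (continuousOn_const.mul huc)).add continuousOn_const)
    (contDiffOn_linear_combination hw hu 1 (-ε) (ε * c)) (fun y hy => ?_) (fun y hy => ?_) hr
    (fun y _ hy => ?_) x hx hxr
  · linarith
  · rw [lap_linear_combination hVo hw hu hy, hul y hy]
    linarith [hwl y hy]
  · rw [hwfr y hy, hufr y hy]
    linarith
  · have hys : y ∈ sphere (0 : EuclideanSpace ℝ (Fin n)) r := by simpa using hy
    have h1 : ε ≤ w y / (u y - c) := hmin hys
    rw [le_div_iff₀ (sub_pos.2 (hcu y (hsub hys)))] at h1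
    linarith

/-- Hopf-type alternative: at a boundary point where the bracket is nonnegative, `Qfun u` cannot
stay below `M * u` by a multiple of `u - c`. -/
lemma not_mul_sub_le_of_bracket_nonneg (hn : 3 ≤ n) (hΩ : IsOpen Ω) (hV : IsOpen V)
    (hu : ContDiffOn ℝ (⊤ : ℕ∞) u V) (h0 : ∀ y ∈ V, 0 < u y) {c r M ε : ℝ}
    (hrΩ : closedBall 0 r ⊆ Ω) (hfr : ∀ x ∈ frontier Ω, u x = c)
    (hcu : ∀ x ∈ Ω \ {(0 : EuclideanSpace ℝ (Fin n))}, c < u x) (hx : x ∈ frontier Ω)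
    (hxV : x ∈ V) (hM : Qfun u x = M * u x) (hg : 0 < ‖gradient u x‖)
    (hbr : 0 ≤ meanH u x / ((n : ℝ) - 1) - ‖gradient u x‖ / (((n : ℝ) - 2) * u x)) (hε : 0 < ε)
    (hdom : ∀ y ∈ Ω, r < ‖y‖ → ε * (u y - c) ≤ M * u y - Qfun u y) (hr : 0 < r) : False := by
  have hxr : r < ‖x‖ := by
    by_contra! h
    rw [hΩ.frontier_eq] at hx
    exact hx.2 (hrΩ (by simpa using h))
  have hpp : fderiv ℝ u x (gradient u x) = ‖gradient u x‖ ^ 2 := by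
    rw [← inner_gradient_eq, real_inner_self_eq_norm_sq]
  have hfar : ∀ᶠ y in 𝓝 x, r < ‖y‖ := continuous_norm.continuousAt.eventually (lt_mem_nhds hxr)
  have hin := eventually_add_smul_mem hΩ hV hu hfr hx hxV
    (hfar.mono fun y hy hyΩ => hcu y ⟨hyΩ, norm_pos_iff.1 (hr.trans hy)⟩)
    (p := gradient u x) (by rw [hpp]; positivity)
  have hray : Tendsto (fun t : ℝ => x + t • gradient u x) (𝓝[>] 0) (𝓝 x) := by
    refine Tendsto.mono_left ?_ nhdsWithin_le_nhds
    have : Continuous fun t : ℝ => x + t • gradient u x := by fun_prop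
    simpa using this.tendsto 0
  have hQ := contDiffOn_Qfun hV hu h0
  have hnn := fderiv_nonneg_of_eventually_nonneg
    (q := fun y => (M - ε) * u y + -1 * Qfun u y + ε * c) (p := gradient u x) hV
    (contDiffOn_linear_combination hu hQ _ _ _) hxV (by rw [hM, hfr x hx]; ring)
    (by
      filter_upwards [hin, hray.eventually hfar] with t ht htr
      linarith [hdom _ ht htr])
  have hud := (differentiableAt_of_contDiffOn_top hV hu hxV).hasFDerivAt
  have hQd := (differentiableAt_of_contDiffOn_top hV hQ hxV).hasFDerivAt
  rw [(((hud.const_mul (M - ε)).fun_add (hQd.const_mul (-1))).add_const (ε * c)).fderiv] at hnn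
  have hQp : fderiv ℝ (Qfun u) x (gradient u x) = ∑ i, pd i u x * pd i (Qfun u) x := by
    rw [fderiv_eq_sum_pd]
    simp only [gradient_apply]
  have hle := mul_norm_gradient_sq_le_of_bracket_nonneg hn hV hu h0 hxV hM hg hbr
  simp only [_root_.add_apply, _root_.smul_apply, smul_eq_mul, hpp,
    hQp] at hnn
  nlinarith [mul_pos hε (pow_pos hg 2)]

lemma continuousOn_bracket (hn : 3 ≤ n) (hV : IsOpen V) (hu : ContDiffOn ℝ (⊤ : ℕ∞) u V)
    (h0 : ∀ y ∈ V, 0 < u y) {K : Set (EuclideanSpace ℝ (Fin n))} (hK : K ⊆ V)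
    (hg : ∀ x ∈ K, 0 < ‖gradient u x‖) :
    ContinuousOn (fun x => meanH u x / ((n : ℝ) - 1) - ‖gradient u x‖ / (((n : ℝ) - 2) * u x))
      K := by
  have hnR : (3 : ℝ) ≤ n := by exact_mod_cast hn
  have hD : ContDiffOn ℝ (⊤ : ℕ∞) (fderiv ℝ u) V := hu.fderiv_of_isOpen hV (by norm_cast)
  have hD2 : ContDiffOn ℝ (⊤ : ℕ∞) (fderiv ℝ (fderiv ℝ u)) V :=
    hD.fderiv_of_isOpen hV (by norm_cast)
  have hgr : ContinuousOn (gradient u) K :=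
    (LinearIsometryEquiv.continuous _).comp_continuousOn (hD.continuousOn.mono hK)
  have hh : ContinuousOn (fun x => hess2 u x (gradient u x) (gradient u x)) K := by
    simp only [hess2_apply]
    exact ((hD2.continuousOn.mono hK).clm_apply hgr).clm_apply hgr
  refine ContinuousOn.sub (ContinuousOn.div_const (hh.div (hgr.norm.pow 3) fun x hx => ?_) _)
    (hgr.norm.div (continuousOn_const.mul (hu.continuousOn.mono hK)) fun x hx => ?_)
  · exact (pow_pos (hg x hx) 3).ne'
  · exact (mul_pos (by linarith) (h0 x (hK hx))).ne'

end Rigidity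

/-- for the interior problem, if the `P`-function is constant on `∂Ω` with value
`sup_{Ω∖{0}} P` and `sup_{∂Ω} [H/(n-1) - |Du|/((n-2)u)] ≥ 0`, then the Hessian identity holds
on `Ω∖{0}`. -/
theorem interior_constant_P_hessian_identity
    (n : ℕ) (hn : 3 ≤ n) (Ω : Set (EuclideanSpace ℝ (Fin n)))
    (u : EuclideanSpace ℝ (Fin n) → ℝ) (d c : ℝ) (hd : 0 < d) (hc : 0 < c)
    (hΩ : GoodDomain Ω) (hu : InteriorSol Ω d c u)
    (hP : ∀ x ∈ frontier Ω,
      Pfun u x = sSup (Pfun u '' (Ω \ {(0 : EuclideanSpace ℝ (Fin n))})))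
    (hsup : sSup ((fun x => meanH u x / ((n : ℝ) - 1) - ‖gradient u x‖ / (((n : ℝ) - 2) * u x)) ''
      frontier Ω) ≥ 0) :
    ∀ x ∈ Ω \ {(0 : EuclideanSpace ℝ (Fin n))}, HessId u x := by
  obtain ⟨hΩo, hΩc, hb, h0Ω⟩ := hΩ
  obtain ⟨⟨U, hUo, hΩU, hus⟩, hul, hfr, v, hvs, hvl, huv⟩ := hu
  have hVo : IsOpen (Ω \ {(0 : EuclideanSpace ℝ (Fin n))}) := hΩo.sdiff isClosed_singleton
  have huU : ContinuousOn u (closure Ω \ {0}) :=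
    hus.continuousOn.mono (sdiff_subset_sdiff_left hΩU)
  have huΩ : ContDiffOn ℝ (⊤ : ℕ∞) u (Ω \ {0}) :=
    hus.mono (sdiff_subset_sdiff_left (subset_closure.trans hΩU))
  have hnR : (3 : ℝ) ≤ n := by exact_mod_cast hn
  set A := d * sArea (frontier Ω) / (((n : ℝ) - 2) * sphereArea n) with hA
  have hA0 : 0 ≤ A :=
    div_nonneg (mul_nonneg hd.le ENNReal.toReal_nonneg)
      (mul_nonneg (by linarith) ENNReal.toReal_nonneg)
  rcases hA0.eq_or_lt with hA0 | hA0
  · rw [← hA0] at huv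
    have hconst := eq_of_removable (by omega) hΩo hb h0Ω huU hvs hvl
      (fun x hx => by rw [huv x hx]; ring) hfr
    exact fun x hx => hessId_of_eqOn_const hVo hconst hx
  obtain ⟨r, hr, hrΩ, C, hpole⟩ := exists_lt_and_Pfun_le_near_pole hn hΩo h0Ω hA0 c hvs huv
  have hcu := lt_of_pole hn hΩo hΩc.isPreconnected hb hr hrΩ huU huΩ hul hfr
    fun x hx hxr => (hpole x hx hxr).1
  have hu0 : ∀ x ∈ Ω \ {(0 : EuclideanSpace ℝ (Fin n))}, 0 < u x :=
    fun x hx => hc.trans (hcu x hx)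
  set W := (U \ {(0 : EuclideanSpace ℝ (Fin n))}) ∩ u ⁻¹' Ioi 0 with hW
  have hWo : IsOpen W :=
    hus.continuousOn.isOpen_inter_preimage (hUo.sdiff isClosed_singleton) isOpen_Ioi
  have huW : ContDiffOn ℝ (⊤ : ℕ∞) u W := hus.mono inter_subset_left
  have hW0 : ∀ y ∈ W, 0 < u y := fun y hy => hy.2
  have hfr0 : ∀ x ∈ frontier Ω, x ∉ Ω := fun x hx => (hΩo.frontier_eq ▸ hx).2
  have hclW : closure Ω \ {0} ⊆ W := by
    rintro x ⟨hx, hx0⟩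
    refine ⟨⟨hΩU hx, hx0⟩, ?_⟩
    by_cases hxΩ : x ∈ Ω
    · exact hu0 x ⟨hxΩ, hx0⟩
    · have : x ∈ frontier Ω := by rw [hΩo.frontier_eq]; exact ⟨hx, hxΩ⟩
      rw [mem_preimage, hfr x this]
      exact hc
  have hfrW : frontier Ω ⊆ W := fun x hx =>
    hclW ⟨frontier_subset_closure hx, fun h => hfr0 x hx (h ▸ h0Ω)⟩
  have hQW := contDiffOn_Qfun hWo huW hW0
  have hQΩ := contDiffOn_Qfun hVo huΩ hu0
  have hPW : ContinuousOn (Pfun u) W :=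
    (hQW.continuousOn.div huW.continuousOn fun y hy => (hW0 y hy).ne').congr fun y hy => by
      rw [Pi.div_apply, ← Pfun_mul_self hn (hW0 y hy), mul_div_cancel_right₀ _ (hW0 y hy).ne']
  have hbdd : BddAbove (Pfun u '' (Ω \ {0})) := by
    have hK : IsCompact (closure Ω \ ball 0 r) := IsCompact.diff hb.isCompact_closure isOpen_ball
    obtain ⟨B, hB⟩ := (hK.image_of_continuousOn (hPW.mono ((sdiff_subset_sdiff_right
      (singleton_subset_iff.2 (mem_ball_self hr))).trans hclW))).bddAbove
    refine ⟨max B C, ?_⟩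
    rintro _ ⟨x, hx, rfl⟩
    rcases le_or_gt ‖x‖ r with h | h
    · exact (hpole x hx.2 h).2.trans (le_max_right _ _)
    · refine (hB ⟨x, ⟨subset_closure hx.1, ?_⟩, rfl⟩).trans (le_max_left _ _)
      simpa using h.le
  set M := sSup (Pfun u '' (Ω \ {0})) with hM
  have hQle : ∀ x ∈ Ω \ {(0 : EuclideanSpace ℝ (Fin n))}, Qfun u x ≤ M * u x := fun x hx => by
    rw [← Pfun_mul_self hn (hu0 x hx)]
    exact mul_le_mul_of_nonneg_right (le_csSup hbdd ⟨x, hx, rfl⟩) (hu0 x hx).le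
  have hQfr : ∀ x ∈ frontier Ω, Qfun u x = M * u x := fun x hx => by
    rw [← Pfun_mul_self hn (hW0 x (hfrW hx)), hP x hx]
  set w : EuclideanSpace ℝ (Fin n) → ℝ := fun y => M * u y + -1 * Qfun u y + 0 with hw
  have hwΩ : ContDiffOn ℝ (⊤ : ℕ∞) w (Ω \ {0}) := contDiffOn_linear_combination huΩ hQΩ _ _ _
  have hwl : ∀ x ∈ Ω \ {(0 : EuclideanSpace ℝ (Fin n))}, lap w x ≤ 0 := fun x hx => by
    rw [hw, lap_linear_combination hVo huΩ hQΩ hx, hul x hx]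
    linarith [lap_Qfun_nonneg hn hVo huΩ hu0 hul hx]
  have hw0 : ∀ x ∈ Ω \ {(0 : EuclideanSpace ℝ (Fin n))}, 0 ≤ w x := fun x hx => by
    have := hQle x hx
    simp only [hw]
    linarith
  by_cases hzero : ∀ x ∈ Ω \ {(0 : EuclideanSpace ℝ (Fin n))}, w x = 0
  · intro x hx
    refine hessId_of_lap_Qfun_eq_zero hn hVo huΩ hu0 hul hx ?_
    have hlw : lap w x = 0 := by rw [lap_congr hVo hzero hx, lap_const]
    rw [hw, lap_linear_combination hVo huΩ hQΩ hx, hul x hx] at hlw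
    linarith
  exfalso
  push Not at hzero
  obtain ⟨y, hy, hwy⟩ := hzero
  have hwpos := pos_of_lap_nonpos_of_isPreconnected hVo (by omega)
    (isPreconnected_diff_singleton (by omega) hΩo hΩc.isPreconnected 0) hwΩ hwl hw0 hy
    ((hw0 y hy).lt_of_ne' hwy)
  have hMpos : 0 < M := by
    have h1 := hwpos y hy
    have h2 : 0 ≤ Qfun u y :=
      mul_nonneg (Finset.sum_nonneg fun i _ => mul_self_nonneg _) (Real.rpow_nonneg (hu0 y hy).le _)
    refine pos_of_mul_pos_left (b := u y) ?_ (hu0 y hy).le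
    simp only [hw] at h1
    linarith
  obtain ⟨ε, hε, hdom⟩ := exists_mul_sub_le (w := w) hn hΩo hb hr hrΩ huU
    ((contDiffOn_linear_combination huW hQW M (-1) 0).continuousOn.mono hclW) huΩ hwΩ hul hwl hfr
    (fun x hx => by simp only [hw]; rw [hQfr x hx]; ring) hcu hwpos
  have hgfr : ∀ x ∈ frontier Ω, 0 < ‖gradient u x‖ := fun x hx => by
    refine norm_pos_iff.2 fun h => ?_
    have hPM : Pfun u x = M := hP x hx
    rw [Pfun, h, norm_zero] at hPM
    simp at hPM
    exact hMpos.ne hPM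
  have hfrne : (frontier Ω).Nonempty := by
    have : Nontrivial (EuclideanSpace ℝ (Fin n)) := by
      have : Nonempty (Fin n) := ⟨⟨0, by omega⟩⟩
      infer_instance
    refine nonempty_frontier_iff.2 ⟨⟨0, h0Ω⟩, fun h => ?_⟩
    exact NormedSpace.unbounded_univ ℝ (EuclideanSpace ℝ (Fin n)) (h ▸ hb)
  have hfrc : IsCompact (frontier Ω) :=
    hb.isCompact_closure.of_isClosed_subset isClosed_frontier frontier_subset_closure
  obtain ⟨x, hx, hxsup⟩ := hfrc.exists_sSup_image_eq hfrne
    (continuousOn_bracket hn hWo huW hW0 hfrW hgfr)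
  rw [hxsup] at hsup
  exact not_mul_sub_le_of_bracket_nonneg hn hΩo hWo huW hW0 hrΩ hfr hcu hx (hfrW hx) (hQfr x hx)
    (hgfr x hx) hsup hε (fun z hz hzr => (hdom z hz hzr).trans (by simp only [hw]; linarith)) hr
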